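/- arXiv:1412.7002 — 2 statements merged into one kernel-verified Lean document; each statement's English description precedes it below -/
import Mathlib

section
/- Let b : ℝ^d × [0,T] → ℝ^d be Borel measurable and let ν be a locally bounded Borel measure on ℝ^d. Let μ¹ = μ¹_t dt and μ² = μ²_t dt be two solutions of the Cauchy problem ∂_t μ + div(b μ) = 0, μ|_{t=0} = ν, and set μ_t = μ¹_t − μ²_t. Assume there is a number C₁ ≥ 0 such that for every ball U ⊂ ℝ^d one can find a number C₂ ≥ 0, a sequence of vector fields b_k ∈ C^∞(ℝ^d × ℝ, ℝ^d) and a sequence of positive functions V_k ∈ C¹(ℝ^d) satisfying: (i) |b_k(x,t)| ≤ C₁ + C₁|x| for all (x,t); (ii) inf_k inf_{x∈U} V_k(x) > 0 and ⟨b_k(x,t), ∇V_k(x)⟩ ≤ (C₂ − 2 max_{|ξ|=1} ⟨𝓑_k(x,t)ξ, ξ⟩) V_k(x) for every k and all (x,t) ∈ U × [0,T], where 𝓑_k = (∂_{x_i} b_k^j)_{i,j≤d}; (iii) ∫₀ᵀ ∫_U |b_k − b| √(V_k) d|μ_t| dt → 0 as k → ∞. Then μ = 0, i.e., μ¹_t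 = μ²_t for almost every t ∈ [0,T]. -/
open MeasureTheory Metric Set Filter
open scoped Topology ENNReal RealInnerProductSpace

noncomputable section

/-- The total variation measure `|a - b|` of the (formal) difference of two
locally finite nonnegative measures, defined via measure subtraction. -/
def tvDiff {α : Type*} [MeasurableSpace α] (a b : Measure α) : Measure α :=
  (a - b) + (b - a)

/-- A family `(μ_t)_{t∈[0,T]}` of locally bounded signed Borel measures on `ℝ^d`,
represented by its Jordan decomposition `μ_t = p t - n t`:  each `p t`, `n t` is
finite on compact sets and they are mutually singular, `t ↦ μ_t(B)` is measurable
for bounded Borel `B`, and `t ↦ |μ_t|(K)` is in `L¹[0,T]` for every compact `K`. -/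
def IsLocFamily {d : ℕ} (T : ℝ)
    (p n : ℝ → Measure (EuclideanSpace ℝ (Fin d))) : Prop :=
  (∀ t ∈ Icc (0:ℝ) T, ∀ K : Set (EuclideanSpace ℝ (Fin d)), IsCompact K →
      p t K < ⊤ ∧ n t K < ⊤) ∧
  (∀ t ∈ Icc (0:ℝ) T, p t ⟂ₘ n t) ∧
  (∀ B : Set (EuclideanSpace ℝ (Fin d)), MeasurableSet B → Bornology.IsBounded B →
      Measurable (fun t => p t B) ∧ Measurable (fun t => n t B)) ∧
  (∀ K : Set (EuclideanSpace ℝ (Fin d)), IsCompact K →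
      IntegrableOn (fun t => (p t K).toReal + (n t K).toReal) (Icc (0:ℝ) T))

/-- Integral of `f` against the signed measure `μ_t = p t - n t`. -/
def sint {d : ℕ} (p n : ℝ → Measure (EuclideanSpace ℝ (Fin d))) (t : ℝ)
    (f : EuclideanSpace ℝ (Fin d) → ℝ) : ℝ :=
  (∫ x, f x ∂(p t)) - ∫ x, f x ∂(n t)

/-- The family `μ_t = p t - n t` is a solution of the Cauchy problem
`∂_t μ + div (b μ) = 0`, `μ|_{t=0} = ν` (`ν = νp - νn`) on `[0,T]`:
`b` is `|μ|`-integrable on `U × [0,T]` for every ball `U` and the weak identity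
`∫ u(x,t) μ_t(dx) = ∫ u(x,0) ν(dx) + ∫₀ᵗ ∫ [∂_t u + ⟨b,∇u⟩] μ_s(dx) ds`
holds for a.e. `t ∈ [0,T]`, for every `C¹` test function `u` vanishing for
`|x| > R` for some `R`. -/
def IsSolution {d : ℕ} (T : ℝ)
    (b : EuclideanSpace ℝ (Fin d) → ℝ → EuclideanSpace ℝ (Fin d))
    (νp νn : Measure (EuclideanSpace ℝ (Fin d)))
    (p n : ℝ → Measure (EuclideanSpace ℝ (Fin d))) : Prop :=
  (∀ (x₀ : EuclideanSpace ℝ (Fin d)) (R : ℝ), 0 < R →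
      (∫⁻ t in Icc (0:ℝ) T,
        ∫⁻ x in ball x₀ R, ENNReal.ofReal ‖b x t‖ ∂(p t + n t)) < ⊤) ∧
  ∀ u : EuclideanSpace ℝ (Fin d) → ℝ → ℝ,
    ContDiff ℝ 1 (fun q : EuclideanSpace ℝ (Fin d) × ℝ => u q.1 q.2) →
    (∃ R > 0, ∀ x t, R < ‖x‖ → u x t = 0) →
    ∀ᵐ t ∂(volume.restrict (Icc (0:ℝ) T)),
      sint p n t (fun x => u x t)
        = ((∫ x, u x 0 ∂νp) - ∫ x, u x 0 ∂νn)
          + ∫ s in Icc (0:ℝ) t,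
              sint p n s (fun x => deriv (u x) s
                + ⟪b x s, gradient (fun y => u y s) x⟫)

section Preparations

open ProbabilityTheory

section TotalVariation

variable {α : Type*} [MeasurableSpace α] {μ ν : Measure α}

lemma tvDiff_le_add : tvDiff μ ν ≤ μ + ν :=
  add_le_add Measure.sub_le Measure.sub_le

lemma restrict_tvDiff {s : Set α} (hs : MeasurableSet s) :
    (tvDiff μ ν).restrict s = tvDiff (μ.restrict s) (ν.restrict s) := by
  simp only [tvDiff, Measure.restrict_add, Measure.restrict_sub_eq_restrict_sub_restrict hs]

lemma add_sub_comm_of_isFiniteMeasure [IsFiniteMeasure μ] [IsFiniteMeasure ν] :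
    μ + (ν - μ) = ν + (μ - ν) := by
  obtain ⟨s, hs⟩ := exists_isHahnDecomposition μ ν
  have key : ∀ {μ ν : Measure α} [IsFiniteMeasure μ] [IsFiniteMeasure ν] (_ : μ ≤ ν),
      μ + (ν - μ) = ν + (μ - ν) := by
    intro μ ν _ _ h
    rw [Measure.sub_eq_zero_of_le h, add_zero, add_comm, Measure.sub_add_cancel_of_le h]
  rw [← Measure.restrict_add_restrict_compl (μ := μ + (ν - μ)) hs.measurableSet,
    ← Measure.restrict_add_restrict_compl (μ := ν + (μ - ν)) hs.measurableSet]
  simp only [Measure.restrict_add,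
    Measure.restrict_sub_eq_restrict_sub_restrict hs.measurableSet,
    Measure.restrict_sub_eq_restrict_sub_restrict hs.measurableSet.compl]
  rw [key hs.le_on, key hs.ge_on_compl]

lemma enorm_integral_sub_integral_le_lintegral_tvDiff [IsFiniteMeasure μ] [IsFiniteMeasure ν]
    {f : α → ℝ} (hμ : Integrable f μ) (hν : Integrable f ν) :
    ‖∫ x, f x ∂μ - ∫ x, f x ∂ν‖ₑ ≤ ∫⁻ x, ‖f x‖ₑ ∂(tvDiff μ ν) := by
  have h1 : Integrable f (μ - ν) := hμ.mono_measure Measure.sub_le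
  have h2 : Integrable f (ν - μ) := hν.mono_measure Measure.sub_le
  have h3 : ∫ x, f x ∂μ + ∫ x, f x ∂(ν - μ) = ∫ x, f x ∂ν + ∫ x, f x ∂(μ - ν) := by
    rw [← integral_add_measure hμ h2, ← integral_add_measure hν h1,
      add_sub_comm_of_isFiniteMeasure]
  have h4 : ∫ x, f x ∂μ - ∫ x, f x ∂ν = ∫ x, f x ∂(μ - ν) - ∫ x, f x ∂(ν - μ) := by linarith
  rw [h4, tvDiff, lintegral_add_measure]
  exact enorm_sub_le.trans
    (add_le_add (enorm_integral_le_lintegral_enorm f) (enorm_integral_le_lintegral_enorm f))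

lemma tvDiff_withDensity {f g : α → ℝ≥0∞} [IsFiniteMeasure (μ.withDensity f)]
    [IsFiniteMeasure (μ.withDensity g)] (hf : Measurable f) (hg : Measurable g) :
    tvDiff (μ.withDensity f) (μ.withDensity g) = μ.withDensity ((f - g) + (g - f)) := by
  rw [tvDiff, ← Measure.withDensity_sub hf hg, ← Measure.withDensity_sub hg hf,
    withDensity_add_left (hf.sub hg)]

end TotalVariation

section Kernels

variable {α β : Type*} [MeasurableSpace α] [MeasurableSpace β]

/-- The kernel `κ` scaled at each point by `(1 + m a)⁻¹`. -/
def scaledKernel (κ : Kernel α β) (m : α → ℝ≥0∞) (hm : Measurable m) : Kernel α β where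
  toFun a := (1 + m a)⁻¹ • κ a
  measurable' := by
    refine Measure.measurable_of_measurable_coe _ fun s hs => ?_
    simp only [Measure.smul_apply, smul_eq_mul]
    exact (measurable_const.add hm).inv.mul (κ.measurable_coe hs)

lemma scaledKernel_apply (κ : Kernel α β) (m : α → ℝ≥0∞) (hm : Measurable m) (a : α) :
    scaledKernel κ m hm a = (1 + m a)⁻¹ • κ a := rfl

lemma isFiniteKernel_scaledKernel (κ : Kernel α β) (m : α → ℝ≥0∞) (hm : Measurable m)
    (h : ∀ a, κ a univ ≤ m a) : IsFiniteKernel (scaledKernel κ m hm) := by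
  refine ⟨1, ENNReal.one_lt_top, fun a => ?_⟩
  rw [scaledKernel_apply, Measure.smul_apply, smul_eq_mul, mul_comm, ← div_eq_mul_inv]
  exact ENNReal.div_le_of_le_mul (by simpa using (h a).trans le_add_self)

lemma smul_scaledKernel (κ : Kernel α β) (m : α → ℝ≥0∞) (hm : Measurable m) (a : α)
    (ha : m a ≠ ⊤) : (1 + m a) • scaledKernel κ m hm a = κ a := by
  rw [scaledKernel_apply, smul_smul, ENNReal.mul_inv_cancel (by simp) (by simp [ha]), one_smul]

lemma isSFiniteKernel_of_isFiniteMeasure (κ : Kernel α β) (h : ∀ a, IsFiniteMeasure (κ a)) :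
    IsSFiniteKernel κ := by
  set m : α → ℝ≥0∞ := fun a => κ a univ
  have hm : Measurable m := κ.measurable_coe MeasurableSet.univ
  have := isFiniteKernel_scaledKernel κ m hm fun a => le_rfl
  have hf : Measurable (Function.uncurry fun (a : α) (_ : β) => 1 + m a) :=
    measurable_const.add (hm.comp measurable_fst)
  have hκ : (scaledKernel κ m hm).withDensity (fun a _ => 1 + m a) = κ := by
    ext1 a
    rw [Kernel.withDensity_apply _ hf, withDensity_const]
    exact smul_scaledKernel κ m hm a (measure_ne_top _ _)
  rw [← hκ]
  exact Kernel.IsSFiniteKernel.withDensity _ fun a _ => by simp [m]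

lemma eq_withDensity_of_withDensity_eq_scaledKernel {κ ζ : Kernel α β} [IsSFiniteKernel ζ]
    {m : α → ℝ≥0∞} (hm : Measurable m) {r : α → β → NNReal} (hr : Measurable (Function.uncurry r))
    (h : ζ.withDensity (fun a x => (r a x : ℝ≥0∞)) = scaledKernel κ m hm) {a : α} (ha : m a ≠ ⊤) :
    κ a = (ζ a).withDensity (fun x => (1 + m a) * (r a x : ℝ≥0∞)) := by
  have hra : Measurable fun x => (r a x : ℝ≥0∞) := hr.of_uncurry_left.coe_nnreal_ennreal
  rw [← smul_scaledKernel κ m hm a ha, ← h, Kernel.withDensity_apply _ hr.coe_nnreal_ennreal,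
    ← withDensity_smul _ hra]
  rfl

lemma exists_kernel_tvDiff [MeasurableSpace.CountableOrCountablyGenerated α β]
    (κ η : Kernel α β) (hκ : ∀ a, IsFiniteMeasure (κ a)) (hη : ∀ a, IsFiniteMeasure (η a)) :
    ∃ ζ : Kernel α β, IsSFiniteKernel ζ ∧ ∀ a, ζ a = tvDiff (κ a) (η a) := by
  set m : α → ℝ≥0∞ := fun a => κ a univ + η a univ
  have hm : Measurable m :=
    (κ.measurable_coe MeasurableSet.univ).add (η.measurable_coe MeasurableSet.univ)
  have hm' : ∀ a, m a ≠ ⊤ := fun a => by simp [m]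
  set κ' := scaledKernel κ m hm
  set η' := scaledKernel η m hm
  have h1 : IsFiniteKernel κ' := isFiniteKernel_scaledKernel κ m hm fun a => le_self_add
  have h2 : IsFiniteKernel η' := isFiniteKernel_scaledKernel η m hm fun a => le_add_self
  set f : α → β → ℝ≥0∞ := fun a x =>
    (1 + m a) * (Real.toNNReal (Kernel.rnDerivAux κ' (κ' + η') a x) : ℝ≥0∞)
  set g : α → β → ℝ≥0∞ := fun a x =>
    (1 + m a) * (Real.toNNReal (1 - Kernel.rnDerivAux κ' (κ' + η') a x) : ℝ≥0∞)
  have hr := Kernel.measurable_rnDerivAux κ' (κ' + η')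
  have hf : Measurable (Function.uncurry f) :=
    (measurable_const.add (hm.comp measurable_fst)).mul hr.real_toNNReal.coe_nnreal_ennreal
  have hg : Measurable (Function.uncurry g) :=
    (measurable_const.add (hm.comp measurable_fst)).mul
      (hr.const_sub 1).real_toNNReal.coe_nnreal_ennreal
  have hfa : ∀ a, Measurable (f a) := fun a => hf.of_uncurry_left
  have hga : ∀ a, Measurable (g a) := fun a => hg.of_uncurry_left
  have hκf : ∀ a, κ a = ((κ' + η') a).withDensity (f a) := fun a =>
    eq_withDensity_of_withDensity_eq_scaledKernel hm hr.real_toNNReal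
      (Kernel.withDensity_rnDerivAux κ' η') (hm' a)
  have hηg : ∀ a, η a = ((κ' + η') a).withDensity (g a) := fun a =>
    eq_withDensity_of_withDensity_eq_scaledKernel hm (hr.const_sub 1).real_toNNReal
      (Kernel.withDensity_one_sub_rnDerivAux κ' η') (hm' a)
  have hfg : Measurable (Function.uncurry ((f - g) + (g - f))) := (hf.sub hg).add (hg.sub hf)
  refine ⟨(κ' + η').withDensity ((f - g) + (g - f)), ?_, fun a => ?_⟩
  · refine Kernel.IsSFiniteKernel.withDensity _ fun a x => ?_
    have e1 : f a x ≠ ⊤ := ENNReal.mul_ne_top (by simp [hm' a]) ENNReal.coe_ne_top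
    have e2 : g a x ≠ ⊤ := ENNReal.mul_ne_top (by simp [hm' a]) ENNReal.coe_ne_top
    exact ENNReal.add_ne_top.2 ⟨ENNReal.sub_ne_top e1, ENNReal.sub_ne_top e2⟩
  · rw [Kernel.withDensity_apply _ hfg]
    have i1 : IsFiniteMeasure (((κ' + η') a).withDensity (f a)) := hκf a ▸ hκ a
    have i2 : IsFiniteMeasure (((κ' + η') a).withDensity (g a)) := hηg a ▸ hη a
    conv_rhs => rw [hκf a, hηg a, tvDiff_withDensity (hfa a) (hga a)]
    rfl

end Kernels

section Calculus

variable {E : Type*} [NormedAddCommGroup E] [InnerProductSpace ℝ E] [FiniteDimensional ℝ E]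

/-- Along a short Euler step of the field `g`, the quantity `‖ξ‖² V` grows at most
exponentially. -/
lemma exists_norm_sq_mul_le_of_euler_step {g : E → ℝ → E}
    (hg : ContDiff ℝ 1 fun q : E × ℝ => g q.1 q.2) {V : E → ℝ} (hV : ContDiff ℝ 1 V)
    (hVpos : ∀ x, 0 < V x) {R T C : ℝ}
    (h : ∀ x ∈ closedBall (0 : E) R, ∀ t ∈ Icc (0 : ℝ) T, ∀ ξ : E, ‖ξ‖ = 1 →
      ⟪g x t, gradient V x⟫ ≤
        (C - 2 * ⟪fderiv ℝ (fun q : E × ℝ => g q.1 q.2) (x, t) (ξ, 0), ξ⟫) * V x) :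
    ∃ δ > 0, ∀ x ∈ closedBall (0 : E) R, ∀ t ∈ Icc (0 : ℝ) T, ∀ τ ∈ Icc (0 : ℝ) δ, ∀ ξ : E,
      ‖ξ + τ • fderiv ℝ (fun q : E × ℝ => g q.1 q.2) (x, t) (ξ, 0)‖ ^ 2 * V (x + τ • g x t) ≤
        (1 + (C + 1) * τ) * ‖ξ‖ ^ 2 * V x := by
  set G : E × ℝ → E := fun q => g q.1 q.2 with hG
  set D : E × ℝ → (E × ℝ →L[ℝ] E) := fderiv ℝ G with hD
  have hDc : Continuous D := hg.continuous_fderiv (by norm_num)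
  have hVc : Continuous (fderiv ℝ V) := hV.continuous_fderiv (by norm_num)
  have hGc : Continuous G := hg.continuous
  have hVc0 : Continuous V := hV.continuous
  -- the derivative in `τ` of the left-hand side minus the claimed bound
  let Q : ℝ × ((E × ℝ) × E) → ℝ := fun p =>
    2 * ⟪p.2.2 + p.1 • D p.2.1 (p.2.2, 0), D p.2.1 (p.2.2, 0)⟫ * V (p.2.1.1 + p.1 • G p.2.1)
      + ‖p.2.2 + p.1 • D p.2.1 (p.2.2, 0)‖ ^ 2 * fderiv ℝ V (p.2.1.1 + p.1 • G p.2.1) (G p.2.1)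
      - (C + 1) * V p.2.1.1
  have hQ : Continuous Q := by
    have e1 : Continuous fun p : ℝ × ((E × ℝ) × E) => D p.2.1 (p.2.2, 0) :=
      (hDc.comp (by fun_prop)).clm_apply (by fun_prop)
    have e2 : Continuous fun p : ℝ × ((E × ℝ) × E) => G p.2.1 := hGc.comp (by fun_prop)
    have e3 : Continuous fun p : ℝ × ((E × ℝ) × E) => p.2.1.1 + p.1 • G p.2.1 := by fun_prop
    have e4 : Continuous fun p : ℝ × ((E × ℝ) × E) =>
        fderiv ℝ V (p.2.1.1 + p.1 • G p.2.1) (G p.2.1) := (hVc.comp e3).clm_apply e2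
    have e5 : Continuous fun p : ℝ × ((E × ℝ) × E) => V (p.2.1.1 + p.1 • G p.2.1) :=
      hVc0.comp e3
    have e6 : Continuous fun p : ℝ × ((E × ℝ) × E) => V p.2.1.1 := hVc0.comp (by fun_prop)
    fun_prop
  set K : Set ((E × ℝ) × E) := (closedBall 0 R ×ˢ Icc 0 T) ×ˢ sphere 0 1
  have hK : IsCompact K := ((isCompact_closedBall 0 R).prod isCompact_Icc).prod (isCompact_sphere 0 1)
  have h0 : ({0} : Set ℝ) ×ˢ K ⊆ Q ⁻¹' Iio 0 := by
    rintro ⟨τ, ⟨x, t⟩, ξ⟩ ⟨hτ, ⟨hx, ht⟩, hξ⟩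
    obtain rfl : τ = 0 := hτ
    have hξ1 : ‖ξ‖ = 1 := by simpa using hξ
    have := h x hx t ht ξ hξ1
    have hgr : ⟪g x t, gradient V x⟫ = fderiv ℝ V x (g x t) := by
      rw [real_inner_comm]
      simp [gradient]
    rw [hgr, real_inner_comm] at this
    have hp := hVpos x
    simp only [mem_preimage, mem_Iio, Q, zero_smul, add_zero, hξ1, hG]
    nlinarith
  obtain ⟨u, v, hu, -, h0u, hKv, huv⟩ := generalized_tube_lemma isCompact_singleton hK
    (isOpen_Iio.preimage hQ) h0
  obtain ⟨δ, hδ, hδu⟩ := Metric.isOpen_iff.1 hu 0 (h0u rfl)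
  refine ⟨δ / 2, by positivity, fun x hx t ht τ hτ ξ => ?_⟩
  have unit : ∀ ξ : E, ‖ξ‖ = 1 →
      ‖ξ + τ • D (x, t) (ξ, 0)‖ ^ 2 * V (x + τ • g x t) ≤ (1 + (C + 1) * τ) * V x := by
    intro ξ hξ
    set F : ℝ → ℝ := fun r => ‖ξ + r • D (x, t) (ξ, 0)‖ ^ 2 * V (x + r • g x t)
    have hF : ∀ r, HasDerivAt F (Q (r, (x, t), ξ) + (C + 1) * V x) r := by
      intro r
      have d1 : HasDerivAt (fun r : ℝ => ξ + r • D (x, t) (ξ, 0)) (D (x, t) (ξ, 0)) r := by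
        simpa using ((hasDerivAt_id r).smul_const (D (x, t) (ξ, 0))).const_add ξ
      have d2 : HasDerivAt (fun r : ℝ => x + r • g x t) (g x t) r := by
        simpa using ((hasDerivAt_id r).smul_const (g x t)).const_add x
      have d3 := ((hV.differentiable (by norm_num)) (x + r • g x t)).hasFDerivAt.comp_hasDerivAt r d2
      refine HasDerivAt.congr_deriv (f := F) (d1.norm_sq.mul d3) ?_
      simp only [Q, hG]
      ring
    have hle := (convex_Icc (0 : ℝ) τ).image_sub_le_mul_sub_of_deriv_le (f := F)
      (fun r _ => (hF r).continuousAt.continuousWithinAt)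
      (fun r _ => (hF r).differentiableAt.differentiableWithinAt) (C := (C + 1) * V x)
      (fun r hr => by
        rw [interior_Icc] at hr
        rw [(hF r).deriv]
        have : Q (r, (x, t), ξ) < 0 := huv ⟨hδu (by
          rw [mem_ball_zero_iff, Real.norm_eq_abs, abs_of_pos hr.1]
          linarith [hr.2, hτ.2]), hKv ⟨⟨hx, ht⟩, by simpa using hξ⟩⟩
        linarith)
      0 ⟨le_rfl, hτ.1⟩ τ ⟨hτ.1, le_rfl⟩ hτ.1
    simp only [F, zero_smul, add_zero, hξ] at hle
    linarith
  by_cases hξ : ξ = 0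
  · have e : ((0 : E), (0 : ℝ)) = 0 := rfl
    simp [hξ, e]
  have hn : ‖ξ‖ ≠ 0 := norm_ne_zero_iff.2 hξ
  have hu := unit (‖ξ‖⁻¹ • ξ) (by rw [norm_smul, norm_inv, norm_norm, inv_mul_cancel₀ hn])
  have e : D (x, t) (‖ξ‖⁻¹ • ξ, 0) = ‖ξ‖⁻¹ • D (x, t) (ξ, 0) := by
    rw [← map_smul]; simp
  rw [e, smul_comm, ← smul_add, norm_smul, norm_inv, norm_norm, mul_pow, inv_pow, mul_assoc,
    inv_mul_le_iff₀ (by positivity)] at hu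
  linarith

/-- A smooth bounded function agreeing with `t ↦ a - t` near a given interval around `a`. -/
lemma exists_contDiff_eq_sub (a : ℝ) {τ : ℝ} (hτ : 0 < τ) :
    ∃ θ : ℝ → ℝ, ContDiff ℝ 1 θ ∧ (∀ t, |t - a| < 2 * τ → θ t = a - t) ∧ ∀ t, |θ t| ≤ 3 * τ := by
  let χ : ContDiffBump a := ⟨2 * τ, 3 * τ, by positivity, by linarith⟩
  refine ⟨fun t => χ t * (a - t), χ.contDiff.mul (by fun_prop), fun t ht => ?_, fun t => ?_⟩
  · beta_reduce
    rw [χ.one_of_mem_closedBall (by rw [mem_closedBall, Real.dist_eq]; exact ht.le), one_mul]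
  · by_cases ht : |t - a| < 3 * τ
    · rw [abs_mul, abs_of_nonneg χ.nonneg, abs_sub_comm]
      calc χ t * |t - a| ≤ 1 * |t - a| := by gcongr; exact χ.le_one
        _ ≤ 3 * τ := by linarith
    · beta_reduce
      rw [χ.zero_of_le_dist (by rw [Real.dist_eq]; exact not_lt.1 ht)]
      simp; positivity

lemma eq_zero_of_abs_le_abs_sub_mul {H m : ℝ → ℝ} {T K t : ℝ} (hT : 0 < T)
    (ht : t ∈ Icc (0 : ℝ) T) (hH : ContinuousOn H (Icc 0 T)) (hm : IntegrableOn m (Icc 0 T))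
    (h : ∀ᵐ r ∂(volume.restrict (Icc (0 : ℝ) T)), |H r| ≤ K * |r - t| * m r) : H t = 0 := by
  by_contra hne
  set ε := |H t| / 2
  have hε : 0 < ε := half_pos (abs_pos.2 hne)
  obtain ⟨δ, hδ, hδH⟩ := Metric.continuousOn_iff.1 hH t ht ε hε
  obtain ⟨α, β, hαβ, htm, hsub, hdist⟩ : ∃ α β : ℝ, α < β ∧ t ∈ Icc α β ∧ Icc α β ⊆ Icc 0 T ∧
      ∀ r ∈ Icc α β, |r - t| < δ := by
    rcases eq_or_lt_of_le ht.2 with rfl | hlt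
    · refine ⟨max 0 (t - δ / 2), t, max_lt hT (by linarith), ⟨max_le ht.1 (by linarith), le_rfl⟩,
        Icc_subset_Icc_left (le_max_left _ _), fun r hr => ?_⟩
      have := (le_max_right 0 (t - δ / 2)).trans hr.1
      rw [abs_sub_lt_iff]; constructor <;> linarith [hr.2]
    · refine ⟨t, min T (t + δ / 2), lt_min hlt (by linarith), ⟨le_rfl, le_min ht.2 (by linarith)⟩,
        Icc_subset_Icc ht.1 (min_le_left _ _), fun r hr => ?_⟩
      have := hr.2.trans (min_le_right T (t + δ / 2))
      rw [abs_sub_lt_iff]; constructor <;> linarith [hr.1]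
  have hnot : ¬ IntervalIntegrable (fun r => (r - t)⁻¹) volume α β := by
    rw [intervalIntegrable_sub_inv_iff, uIcc_of_le hαβ.le]
    simp [hαβ.ne, htm]
  refine hnot ((intervalIntegrable_iff_integrableOn_Icc_of_le hαβ.le).2 ?_)
  refine Integrable.mono' (g := fun r => K / ε * m r) ((hm.mono_set hsub).const_mul _)
    (by measurability) ?_
  have hne : ∀ᵐ r ∂(volume : Measure ℝ), r ≠ t := Measure.ae_ne volume t
  filter_upwards [ae_restrict_of_ae_restrict_of_subset hsub h, ae_restrict_of_ae hne,
    ae_restrict_mem measurableSet_Icc] with r hr hrt hmem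
  have h1 : |H r - H t| < ε := hδH r (hsub hmem) (hdist r hmem)
  have h2 : ε ≤ |H r| := by
    have := abs_sub_abs_le_abs_sub (H t) (H r)
    rw [abs_sub_comm] at this
    have : |H t| = 2 * ε := by simp [ε]; ring
    linarith
  have hpos : 0 < |r - t| := abs_pos.2 (sub_ne_zero.2 hrt)
  rw [norm_inv, Real.norm_eq_abs, inv_le_iff_one_le_mul₀ hpos, div_mul_eq_mul_div,
    div_mul_eq_mul_div, le_div_iff₀ hε]
  linarith

end Calculus

section Transport

variable {E : Type*} [NormedAddCommGroup E] [InnerProductSpace ℝ E] [FiniteDimensional ℝ E]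
  [MeasurableSpace E] [BorelSpace E]

/-- Integral of the time slice `h (·, s)` against the signed measure `a s - c s`. -/
def signedIntegral (a c : Kernel ℝ E) (h : E × ℝ → ℝ) (s : ℝ) : ℝ :=
  ∫ x, h (x, s) ∂(a s) - ∫ x, h (x, s) ∂(c s)

/-- The transport operator `∂ₜu + ⟨b, ∇u⟩`. -/
def transportDeriv (b : E × ℝ → E) (u : E × ℝ → ℝ) (q : E × ℝ) : ℝ :=
  fderiv ℝ u q (b q, 1)

/-- Two kernels of finite measures, of finite total mass over `[0, T]` and integrating the field
`b` over `[0, T]`. -/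
structure IsKernelPair (T : ℝ) (b : E × ℝ → E) (a c : Kernel ℝ E) : Prop where
  finite_left : ∀ t, IsFiniteMeasure (a t)
  finite_right : ∀ t, IsFiniteMeasure (c t)
  measurable_field : Measurable b
  mass_lt_top : ∫⁻ s in Icc 0 T, (a s + c s) univ < ⊤
  field_lt_top : ∫⁻ s in Icc 0 T, ∫⁻ x, ‖b (x, s)‖ₑ ∂(a s + c s) < ⊤

/-- A kernel pair whose difference solves the continuity equation driven by `b` on `[0, T]`
with zero initial datum, tested against functions supported well inside the ball of radius `R`. -/
structure IsTransportPair (T R : ℝ) (b : E × ℝ → E) (a c : Kernel ℝ E) : Prop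
    extends IsKernelPair T b a c where
  weak : ∀ u : E × ℝ → ℝ, ContDiff ℝ 1 u → ∀ ρ < R, (∀ x t, ρ < ‖x‖ → u (x, t) = 0) →
    ∀ᵐ t ∂(volume.restrict (Icc 0 T)),
      signedIntegral a c u t = ∫ s in Icc 0 t, signedIntegral a c (transportDeriv b u) s

lemma measurable_transportDeriv {b : E × ℝ → E} (hb : Measurable b) {u : E × ℝ → ℝ}
    (hu : ContDiff ℝ 1 u) : Measurable (transportDeriv b u) := by
  have h1 : Measurable (fderiv ℝ u) := (hu.continuous_fderiv (by norm_num)).measurable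
  have h2 : Measurable fun q => (b q, (1 : ℝ)) := hb.prodMk measurable_const
  have : Continuous fun p : (E × ℝ →L[ℝ] ℝ) × (E × ℝ) => p.1 p.2 := by fun_prop
  exact this.measurable.comp (h1.prodMk h2)

lemma abs_transportDeriv_le {b : E × ℝ → E} {u : E × ℝ → ℝ} {K : ℝ} {q : E × ℝ}
    (h : ‖fderiv ℝ u q‖ ≤ K) : |transportDeriv b u q| ≤ K * (1 + ‖b q‖) := by
  have h1 : ‖(b q, (1 : ℝ))‖ ≤ 1 + ‖b q‖ := by
    rw [Prod.norm_def, norm_one]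
    exact max_le (by linarith) (by linarith [norm_nonneg (b q)])
  calc |transportDeriv b u q| ≤ ‖fderiv ℝ u q‖ * ‖(b q, (1 : ℝ))‖ :=
        (fderiv ℝ u q).le_opNorm _
    _ ≤ K * (1 + ‖b q‖) := by 
        exact mul_le_mul h h1 (norm_nonneg _) ((ContinuousLinearMap.opNorm_nonneg _).trans h)

lemma exists_norm_fderiv_le {u : E × ℝ → ℝ} (hu : ContDiff ℝ 1 u) {ρ : ℝ}
    (hρ : ∀ x t, ρ < ‖x‖ → u (x, t) = 0) (T : ℝ) :
    ∃ K, 0 ≤ K ∧ ∀ x, ∀ s ∈ Icc 0 T, ‖fderiv ℝ u (x, s)‖ ≤ K := by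
  have hc := hu.continuous_fderiv (by norm_num)
  obtain ⟨K, hK⟩ := ((isCompact_closedBall (0 : E) ρ).prod (isCompact_Icc (a := 0) (b := T))).exists_bound_of_continuousOn hc.continuousOn
  refine ⟨max K 0, le_max_right _ _, fun x s hs => ?_⟩
  by_cases hx : ‖x‖ ≤ ρ
  · exact (hK (x, s) ⟨by simpa using hx, hs⟩).trans (le_max_left _ _)
  · have : u =ᶠ[𝓝 (x, s)] fun _ => 0 := by
      have ho : IsOpen {q : E × ℝ | ρ < ‖q.1‖} := isOpen_lt (by fun_prop) (by fun_prop)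
      filter_upwards [ho.mem_nhds (show (x, s) ∈ _ from not_le.1 hx)] with q hq
      exact hρ q.1 q.2 hq
    rw [this.fderiv_eq, fderiv_const_apply, ContinuousLinearMap.opNorm_zero]
    exact le_max_right _ _

/-- The time-integrated flux of the signed measure through a time independent test function. -/
def transportFlux (a c : Kernel ℝ E) (b : E × ℝ → E) (φ : E → ℝ) (t : ℝ) : ℝ :=
  ∫ s in Icc 0 t, signedIntegral a c (transportDeriv b fun q => φ q.1) s

lemma enorm_signedIntegral_le {a c : Kernel ℝ E} (h : E × ℝ → ℝ) (s : ℝ) :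
    ‖signedIntegral a c h s‖ₑ ≤ ∫⁻ x, ‖h (x, s)‖ₑ ∂(a s + c s) := by
  rw [lintegral_add_measure]
  exact (enorm_sub_le).trans
    (add_le_add (enorm_integral_le_lintegral_enorm _) (enorm_integral_le_lintegral_enorm _))

namespace IsKernelPair

variable {T : ℝ} {b : E × ℝ → E} {a c : Kernel ℝ E}

lemma isSFiniteKernel_left (H : IsKernelPair T b a c) : IsSFiniteKernel a :=
  isSFiniteKernel_of_isFiniteMeasure a H.finite_left

lemma isSFiniteKernel_right (H : IsKernelPair T b a c) : IsSFiniteKernel c :=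
  isSFiniteKernel_of_isFiniteMeasure c H.finite_right

lemma measurable_lintegral (H : IsKernelPair T b a c) {f : E × ℝ → ℝ≥0∞}
    (hf : Measurable f) : Measurable fun s => ∫⁻ x, f (x, s) ∂(a s + c s) := by
  have := H.isSFiniteKernel_left
  have := H.isSFiniteKernel_right
  simp_rw [lintegral_add_measure]
  exact (Measurable.lintegral_kernel_prod_right (f := fun s x => f (x, s))
    (hf.comp measurable_swap)).add
    (Measurable.lintegral_kernel_prod_right (f := fun s x => f (x, s)) (hf.comp measurable_swap))

lemma integrableOn_mass (H : IsKernelPair T b a c) :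
    IntegrableOn (fun s => ((a s + c s) univ).toReal) (Icc 0 T) := by
  refine integrable_toReal_of_lintegral_ne_top ?_ H.mass_lt_top.ne
  have := H.measurable_lintegral (f := fun _ => 1) measurable_const
  simp only [lintegral_const, one_mul] at this
  exact this.aemeasurable

lemma lintegral_one_add_lt_top (H : IsKernelPair T b a c) (K : ℝ) :
    ∫⁻ s in Icc 0 T, ∫⁻ x, ENNReal.ofReal (K * (1 + ‖b (x, s)‖)) ∂(a s + c s) < ⊤ := by
  have hbe : Measurable fun q => ‖b q‖ₑ := H.measurable_field.enorm
  have key : ∀ x s, ENNReal.ofReal (K * (1 + ‖b (x, s)‖)) ≤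
      ENNReal.ofReal |K| * (1 + ‖b (x, s)‖ₑ) := by
    intro x s
    rw [← ofReal_norm, ← ENNReal.ofReal_one, ← ENNReal.ofReal_add zero_le_one (norm_nonneg _),
      ← ENNReal.ofReal_mul (abs_nonneg K)]
    gcongr
    exact le_abs_self K
  have hm1 : Measurable fun s => ∫⁻ x, (1 + ‖b (x, s)‖ₑ) ∂(a s + c s) :=
    H.measurable_lintegral (f := fun q => 1 + ‖b q‖ₑ) (hbe.const_add 1)
  calc ∫⁻ s in Icc 0 T, ∫⁻ x, ENNReal.ofReal (K * (1 + ‖b (x, s)‖)) ∂(a s + c s)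
      ≤ ∫⁻ s in Icc 0 T, ENNReal.ofReal |K| *
          ((a s + c s) univ + ∫⁻ x, ‖b (x, s)‖ₑ ∂(a s + c s)) := by
        refine lintegral_mono fun s => (lintegral_mono fun x => key x s).trans ?_
        rw [lintegral_const_mul' _ _ ENNReal.ofReal_ne_top, lintegral_add_left measurable_const]
        simp
    _ < ⊤ := by
        rw [lintegral_const_mul' _ _ ENNReal.ofReal_ne_top,
          lintegral_add_right _ (H.measurable_lintegral hbe)]
        exact ENNReal.mul_lt_top ENNReal.ofReal_lt_top
          (ENNReal.add_lt_top.2 ⟨H.mass_lt_top, H.field_lt_top⟩)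

lemma integrableOn_signedIntegral (H : IsKernelPair T b a c) {h : E × ℝ → ℝ}
    (hh : Measurable h) {K : ℝ} (hK : ∀ x, ∀ s ∈ Icc 0 T, |h (x, s)| ≤ K * (1 + ‖b (x, s)‖)) :
    IntegrableOn (signedIntegral a c h) (Icc 0 T) := by
  have := H.isSFiniteKernel_left
  have := H.isSFiniteKernel_right
  have hs : StronglyMeasurable fun p : ℝ × E => h (p.2, p.1) :=
    (hh.comp measurable_swap).stronglyMeasurable
  refine ⟨(StronglyMeasurable.sub (hs.integral_kernel_prod_right' (κ := a))
    (hs.integral_kernel_prod_right' (κ := c))).aestronglyMeasurable, ?_⟩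
  refine lt_of_le_of_lt (setLIntegral_mono' measurableSet_Icc fun s hs => ?_)
    (H.lintegral_one_add_lt_top K)
  refine (enorm_signedIntegral_le h s).trans (lintegral_mono fun x => ?_)
  rw [← ofReal_norm]
  exact ENNReal.ofReal_le_ofReal (hK x s hs)

lemma ae_integrable (H : IsKernelPair T b a c) {h : E × ℝ → ℝ}
    (hh : Measurable h) {K : ℝ} (hK : ∀ x, ∀ s ∈ Icc 0 T, |h (x, s)| ≤ K * (1 + ‖b (x, s)‖)) :
    ∀ᵐ s ∂(volume.restrict (Icc 0 T)), Integrable (fun x => h (x, s)) (a s + c s) := by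
  have hm : Measurable fun s => ∫⁻ x, ENNReal.ofReal (K * (1 + ‖b (x, s)‖)) ∂(a s + c s) :=
    H.measurable_lintegral (f := fun q => ENNReal.ofReal (K * (1 + ‖b q‖)))
      ((H.measurable_field.norm.const_add 1).const_mul K).ennreal_ofReal
  filter_upwards [ae_lt_top hm (H.lintegral_one_add_lt_top K).ne,
    ae_restrict_mem measurableSet_Icc] with s hs hsT
  refine ⟨(hh.comp measurable_prodMk_right).aestronglyMeasurable,
    lt_of_le_of_lt (lintegral_mono fun x => ?_) hs⟩
  rw [← ofReal_norm]
  exact ENNReal.ofReal_le_ofReal (hK x s hsT)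

lemma ae_enorm_signedIntegral_le (H : IsKernelPair T b a c) {h : E × ℝ → ℝ}
    (hh : Measurable h) {K : ℝ} (hK : ∀ x, ∀ s ∈ Icc 0 T, |h (x, s)| ≤ K * (1 + ‖b (x, s)‖)) :
    ∀ᵐ s ∂(volume.restrict (Icc 0 T)),
      ‖signedIntegral a c h s‖ₑ ≤ ∫⁻ x, ‖h (x, s)‖ₑ ∂(tvDiff (a s) (c s)) := by
  filter_upwards [H.ae_integrable hh hK] with s hs
  have := H.finite_left s
  have := H.finite_right s
  exact enorm_integral_sub_integral_le_lintegral_tvDiff hs.left_of_add_measure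
    hs.right_of_add_measure

end IsKernelPair

lemma IsTransportPair.transportFlux_eq {T R : ℝ} {b : E × ℝ → E} {a c : Kernel ℝ E}
    (H : IsTransportPair T R b a c) (hT : 0 < T) {u : E × ℝ → ℝ}
    (hu : ContDiff ℝ 1 u) {ρ : ℝ} (hρR : ρ < R) (hρ : ∀ x t, ρ < ‖x‖ → u (x, t) = 0)
    {t : ℝ} (ht : t ∈ Icc 0 T) :
    transportFlux a c b (fun x => u (x, t)) t =
      ∫ s in Icc 0 t, signedIntegral a c (transportDeriv b u) s := by
  set v : E × ℝ → ℝ := fun q => u (q.1, t) with hv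
  have hvC : ContDiff ℝ 1 v := hu.comp (by fun_prop)
  have hvρ : ∀ x s, ρ < ‖x‖ → v (x, s) = 0 := fun x s hx => hρ x t hx
  obtain ⟨K, hK0, hK⟩ := exists_norm_fderiv_le hu hρ T
  obtain ⟨K', -, hK'⟩ := exists_norm_fderiv_le hvC hvρ T
  have i1 := H.integrableOn_signedIntegral (measurable_transportDeriv H.measurable_field hu)
    fun x s hs => abs_transportDeriv_le (hK x s hs)
  have i2 := H.integrableOn_signedIntegral (measurable_transportDeriv H.measurable_field hvC)
    fun x s hs => abs_transportDeriv_le (hK' x s hs)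
  have hlip : ∀ x, ∀ r ∈ Icc 0 T, |u (x, r) - u (x, t)| ≤ K * |r - t| := by
    intro x r hr
    have := (convex_Icc (0 : ℝ) T).norm_image_sub_le_of_norm_hasDerivWithin_le
      (f := fun r => u (x, r)) (f' := fun r => fderiv ℝ u (x, r) (0, 1)) (C := K)
      (fun r _ => by
        have h1 : HasDerivAt (fun r : ℝ => (x, r)) ((0 : E), (1 : ℝ)) r :=
          (hasDerivAt_const r x).prodMk (hasDerivAt_id r)
        exact ((hu.differentiable (by norm_num) (x, r)).hasFDerivAt.comp_hasDerivAt r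
          h1).hasDerivWithinAt)
      (fun r hr => by
        refine ((fderiv ℝ u (x, r)).le_of_opNorm_le (hK x r hr) _).trans_eq ?_
        simp [Prod.norm_def]) ht hr
    simpa using this
  have hz := eq_zero_of_abs_le_abs_sub_mul (K := K) hT ht
    (H := fun r => (∫ s in Icc 0 r, signedIntegral a c (transportDeriv b u) s) -
      ∫ s in Icc 0 r, signedIntegral a c (transportDeriv b v) s)
    ((intervalIntegral.continuousOn_primitive_Icc i1).sub
      (intervalIntegral.continuousOn_primitive_Icc i2)) H.integrableOn_mass (by
      have hub : ∀ {w : E × ℝ → ℝ}, ContDiff ℝ 1 w → (∀ x t, ρ < ‖x‖ → w (x, t) = 0) →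
          ∀ r (m : Measure E) [IsFiniteMeasure m], Integrable (fun x => w (x, r)) m := by
        intro w hw hwρ r m _
        have hc : Continuous fun x => w (x, r) := hw.continuous.comp (by fun_prop)
        refine hc.integrable_of_hasCompactSupport ?_
        refine HasCompactSupport.of_support_subset_isCompact (isCompact_closedBall 0 ρ) ?_
        intro x hx
        by_contra hx'
        exact hx (hwρ x r (by simpa using hx'))
      filter_upwards [H.weak u hu ρ hρR hρ, H.weak v hvC ρ hρR hvρ,
        ae_restrict_mem measurableSet_Icc] with r h1 h2 hr
      have := H.finite_left r
      have := H.finite_right r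
      rw [← h1, ← h2]
      have e : signedIntegral a c u r - signedIntegral a c v r =
          signedIntegral a c (fun q => u q - v q) r := by
        simp only [signedIntegral]
        rw [integral_sub (hub hu hρ r _) (hub hvC hvρ r _),
          integral_sub (hub hu hρ r _) (hub hvC hvρ r _)]
        ring
      rw [e]
      have hle : ‖signedIntegral a c (fun q => u q - v q) r‖ₑ ≤
          ENNReal.ofReal (K * |r - t|) * (a r + c r) univ := by
        refine (enorm_signedIntegral_le _ r).trans ?_
        rw [← lintegral_const]
        refine lintegral_mono fun x => ?_
        rw [← ofReal_norm]
        exact ENNReal.ofReal_le_ofReal (hlip x r hr)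
      have := ENNReal.toReal_mono (ENNReal.mul_ne_top ENNReal.ofReal_ne_top (measure_ne_top _ _)) hle
      rwa [ENNReal.toReal_mul, ENNReal.toReal_ofReal (by positivity), toReal_enorm,
        Real.norm_eq_abs] at this)
  exact (sub_eq_zero.1 hz).symm

end Transport

section Euler

variable {E : Type*} [NormedAddCommGroup E] [InnerProductSpace ℝ E]

/-- Compactly supported `C¹` functions whose gradient is controlled by `Λ √V`. -/
structure IsTestFunction (V : E → ℝ) (Λ P : ℝ) (φ : E → ℝ) : Prop where
  contDiff : ContDiff ℝ 1 φ
  eq_zero : ∀ x, P < 1 + ‖x‖ → φ x = 0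
  abs_fderiv_le : ∀ x ξ, |fderiv ℝ φ x ξ| ≤ Λ * √(V x) * ‖ξ‖

/-- A field `g` of linear growth whose short Euler steps distort the metric `V |ξ|²` at most
exponentially on the ball of radius `P`. -/
structure IsEulerField (T δ M C K P : ℝ) (g : E × ℝ → E) (V : E → ℝ) : Prop where
  contDiff : ContDiff ℝ 1 g
  growth_nonneg : 0 ≤ C
  rate_nonneg : 0 ≤ M
  norm_le : ∀ q, ‖g q‖ ≤ C + C * ‖q.1‖
  distortion : ∀ x ∈ closedBall (0 : E) P, ∀ t ∈ Icc 0 T, ∀ τ ∈ Icc 0 δ, ∀ ξ : E,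
    ‖ξ + τ • fderiv ℝ g (x, t) (ξ, 0)‖ * √(V (x + τ • g (x, t))) ≤
      Real.exp (M * τ) * ‖ξ‖ * √(V x)
  acceleration : ∀ x ∈ closedBall (0 : E) P, ∀ y ∈ closedBall (0 : E) P, ∀ t ∈ Icc 0 T,
    √(V y) * ‖fderiv ℝ g (x, t) (g (x, t), 1)‖ ≤ K

lemma IsTestFunction.fderiv_eq_zero {V : E → ℝ} {Λ P : ℝ} {φ : E → ℝ}
    (h : IsTestFunction V Λ P φ) {x : E} (hx : P < 1 + ‖x‖) : fderiv ℝ φ x = 0 := by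
  have ho : IsOpen {y : E | P < 1 + ‖y‖} := isOpen_lt (by fun_prop) (by fun_prop)
  have : φ =ᶠ[𝓝 x] fun _ => 0 := by
    filter_upwards [ho.mem_nhds hx] with y hy using h.eq_zero y hy
  rw [this.fderiv_eq, fderiv_const_apply]

lemma one_le_exp_mul_one_sub {z : ℝ} (h0 : 0 ≤ z) (h1 : z ≤ 1 / 2) :
    1 ≤ Real.exp (2 * z) * (1 - z) := by
  have := Real.add_one_le_exp (2 * z)
  nlinarith

namespace IsEulerField

variable {T δ M C K P : ℝ} {g : E × ℝ → E} {V : E → ℝ}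

lemma one_add_norm_mul_le (hg : IsEulerField T δ M C K P g V) (x : E) (t σ : ℝ) :
    (1 + ‖x‖) * (1 - |σ| * C) ≤ 1 + ‖x + σ • g (x, t)‖ := by
  have h1 : ‖x‖ ≤ ‖x + σ • g (x, t)‖ + ‖σ • g (x, t)‖ := by
    simpa using norm_sub_le (x + σ • g (x, t)) (σ • g (x, t))
  rw [norm_smul, Real.norm_eq_abs] at h1
  nlinarith [mul_le_mul_of_nonneg_left (hg.norm_le (x, t)) (abs_nonneg σ)]

lemma one_add_norm_le (hg : IsEulerField T δ M C K P g V) {x : E} {t σ Q : ℝ}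
    (h0 : 0 ≤ σ) (h1 : σ * C ≤ 1 / 2) (h : 1 + ‖x + σ • g (x, t)‖ ≤ Q) :
    1 + ‖x‖ ≤ Q * Real.exp (2 * C * σ) := by
  have h2 := one_le_exp_mul_one_sub (mul_nonneg h0 hg.growth_nonneg) h1
  have h3 := (hg.one_add_norm_mul_le x t σ).trans h
  rw [abs_of_nonneg h0] at h3
  have he := Real.exp_pos (2 * (σ * C))
  calc 1 + ‖x‖ ≤ (1 + ‖x‖) * (Real.exp (2 * (σ * C)) * (1 - σ * C)) :=
        le_mul_of_one_le_right (by positivity) h2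
    _ = (1 + ‖x‖) * (1 - σ * C) * Real.exp (2 * (σ * C)) := by ring
    _ ≤ Q * Real.exp (2 * (σ * C)) := by gcongr
    _ = Q * Real.exp (2 * C * σ) := by ring_nf

lemma abs_fderiv_le (hg : IsEulerField T δ M C K P g V) {Λ Q : ℝ} {φ : E → ℝ} (hΛ : 0 ≤ Λ)
    (hφ : IsTestFunction V Λ Q φ) {σ : ℝ} (hσ : σ ∈ Icc 0 δ) (hσC : σ * C ≤ 1 / 2)
    (hQ : Q * Real.exp (2 * C * σ) ≤ P) (x : E) {t : ℝ} (ht : t ∈ Icc 0 T) (ξ : E) :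
    |fderiv ℝ φ (x + σ • g (x, t)) (ξ + σ • fderiv ℝ g (x, t) (ξ, 0))| ≤
      Λ * Real.exp (M * σ) * √(V x) * ‖ξ‖ := by
  by_cases hy : Q < 1 + ‖x + σ • g (x, t)‖
  · rw [hφ.fderiv_eq_zero hy]
    simp only [_root_.zero_apply, abs_zero]
    positivity
  · have hx : x ∈ closedBall 0 P := by
      rw [mem_closedBall_zero_iff]
      linarith [hg.one_add_norm_le hσ.1 hσC (not_lt.1 hy)]
    refine (hφ.abs_fderiv_le _ _).trans ?_
    have := mul_le_mul_of_nonneg_left (hg.distortion x hx t ht σ hσ ξ) hΛ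
    linarith

lemma abs_fderiv_acceleration_le (hg : IsEulerField T δ M C K P g V) {Λ Q : ℝ} {φ : E → ℝ}
    (hΛ : 0 ≤ Λ) (hK : 0 ≤ K)
    (hφ : IsTestFunction V Λ Q φ) {σ : ℝ} (hσ : 0 ≤ σ) (hσC : σ * C ≤ 1 / 2)
    (hQ : Q * Real.exp (2 * C * σ) ≤ P) (x : E) {t : ℝ} (ht : t ∈ Icc 0 T) :
    |fderiv ℝ φ (x + σ • g (x, t)) (fderiv ℝ g (x, t) (g (x, t), 1))| ≤ Λ * K := by
  by_cases hy : Q < 1 + ‖x + σ • g (x, t)‖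
  · rw [hφ.fderiv_eq_zero hy]
    simp only [_root_.zero_apply, abs_zero]
    positivity
  · have hx := hg.one_add_norm_le hσ hσC (not_lt.1 hy)
    have hxP : x ∈ closedBall 0 P := by
      rw [mem_closedBall_zero_iff]; linarith
    have hyP : x + σ • g (x, t) ∈ closedBall 0 P := by
      rw [mem_closedBall_zero_iff]
      have hQ0 : 0 ≤ Q := by linarith [norm_nonneg (x + σ • g (x, t))]
      have : 1 ≤ Real.exp (2 * C * σ) :=
        Real.one_le_exp (mul_nonneg (mul_nonneg zero_le_two hg.growth_nonneg) hσ)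
      nlinarith
    refine (hφ.abs_fderiv_le _ _).trans ?_
    rw [mul_assoc]
    exact mul_le_mul_of_nonneg_left (hg.acceleration x hxP _ hyP t ht) hΛ

lemma hasFDerivAt_comp_step (hg : ContDiff ℝ 1 g) {φ : E → ℝ} (hφ : ContDiff ℝ 1 φ)
    {θ : ℝ → ℝ} {θ' : ℝ} {x : E} {t : ℝ} (hθ : HasDerivAt θ θ' t) (β : E) (r : ℝ) :
    fderiv ℝ (fun q : E × ℝ => φ (q.1 + θ q.2 • g q)) (x, t) (β, r) =
      fderiv ℝ φ (x + θ t • g (x, t))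
        (β + ((r * θ') • g (x, t) + θ t • fderiv ℝ g (x, t) (β, r))) := by
  have h0 : HasFDerivAt (Prod.snd : E × ℝ → ℝ) (ContinuousLinearMap.snd ℝ E ℝ) (x, t) :=
    hasFDerivAt_snd
  have h1 : HasFDerivAt (fun q : E × ℝ => θ q.2) (θ' • ContinuousLinearMap.snd ℝ E ℝ) (x, t) :=
    HasDerivAt.comp_hasFDerivAt (h₂ := θ) (f := Prod.snd) (x, t) hθ h0
  have h2 : HasFDerivAt g (fderiv ℝ g (x, t)) (x, t) :=
    (hg.differentiable (by norm_num) (x, t)).hasFDerivAt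
  have h3 := hasFDerivAt_fst.add (h1.smul h2)
  have h4 := (hφ.differentiable (by norm_num) (x + θ t • g (x, t))).hasFDerivAt
  have h5 := HasFDerivAt.comp (x, t) (f := fun q : E × ℝ => q.1 + θ q.2 • g q) h4 h3
  have h6 := h5.fderiv
  rw [show (φ ∘ fun q : E × ℝ => q.1 + θ q.2 • g q) = fun q : E × ℝ => φ (q.1 + θ q.2 • g q) from rfl] at h6
  rw [h6]
  simp [mul_comm, add_comm]

lemma isTestFunction_step (hg : IsEulerField T δ M C K P g V) {Λ Q : ℝ} {φ : E → ℝ} (hΛ : 0 ≤ Λ)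
    (hφ : IsTestFunction V Λ Q φ) {σ : ℝ} (hσ : σ ∈ Icc 0 δ) (hσC : σ * C ≤ 1 / 2)
    (hQ : Q * Real.exp (2 * C * σ) ≤ P) {t : ℝ} (ht : t ∈ Icc 0 T) :
    IsTestFunction V (Λ * Real.exp (M * σ)) (Q * Real.exp (2 * C * σ))
      (fun x => φ (x + σ • g (x, t))) where
  contDiff := hφ.contDiff.comp (contDiff_id.add
    ((hg.contDiff.comp (by fun_prop : ContDiff ℝ 1 fun x : E => (x, t))).const_smul σ))
  eq_zero x hx := hφ.eq_zero _ (by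
    by_contra h
    exact absurd (hg.one_add_norm_le hσ.1 hσC (not_lt.1 h)) (not_le.2 hx))
  abs_fderiv_le x ξ := by
    have h1 : HasFDerivAt (fun x : E => x + σ • g (x, t))
        (ContinuousLinearMap.id ℝ E +
          σ • (fderiv ℝ g (x, t)).comp ((ContinuousLinearMap.id ℝ E).prod 0)) x :=
      (hasFDerivAt_id x).add (((hg.contDiff.differentiable (by norm_num)
        (x, t)).hasFDerivAt.comp x ((hasFDerivAt_id x).prodMk (hasFDerivAt_const t x))).const_smul σ)
    have h2 := ((hφ.contDiff.differentiable (by norm_num)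
      (x + σ • g (x, t))).hasFDerivAt.comp x h1).fderiv
    rw [show (φ ∘ fun x : E => x + σ • g (x, t)) = fun x : E => φ (x + σ • g (x, t)) from rfl] at h2
    rw [h2]
    simpa using hg.abs_fderiv_le hΛ hφ hσ hσC hQ x ht ξ

end IsEulerField

end Euler

section Iteration

variable {E : Type*} [NormedAddCommGroup E] [InnerProductSpace ℝ E] [FiniteDimensional ℝ E]
  [MeasurableSpace E] [BorelSpace E]
  {T δ M C K P : ℝ} {b g : E × ℝ → E} {V : E → ℝ} {a c : Kernel ℝ E}

/-- The weighted distance between the fields `b` and `g` at time `s`, measured by `|a s - c s|`. -/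
def fieldDist (a c : Kernel ℝ E) (b g : E × ℝ → E) (V : E → ℝ) (s : ℝ) : ℝ≥0∞ :=
  ∫⁻ x, ENNReal.ofReal (‖g (x, s) - b (x, s)‖ * √(V x)) ∂(tvDiff (a s) (c s))

lemma IsTransportPair.exists_euler_step (H : IsTransportPair T (2 * P) b a c)
    (hg : IsEulerField T δ M C K P g V) (hK : 0 ≤ K) (hP : 0 < P)
    {Λ L Q t τ : ℝ} {φ : E → ℝ} (hΛ : 0 ≤ Λ) (hφ : IsTestFunction V Λ Q φ)
    (ht : 0 ≤ t) (htT : t + τ ≤ T) (hτ : 0 < τ) (hτδ : τ ≤ δ) (hτC : 3 * τ * C ≤ 1 / 2)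
    (hQ : Q * Real.exp (2 * C * τ) ≤ P) (hQ0 : 0 ≤ Q) (hL : Λ * Real.exp (M * τ) ≤ L) :
    ∃ φ' : E → ℝ, IsTestFunction V (Λ * Real.exp (M * τ)) (Q * Real.exp (2 * C * τ)) φ' ∧
      ‖transportFlux a c b φ (t + τ) - transportFlux a c b φ' t‖ₑ ≤
        ∫⁻ s in Ioc t (t + τ), (ENNReal.ofReal L * fieldDist a c b g V s +
          ENNReal.ofReal (τ * (L * K)) * (a s + c s) univ) := by
  have hT : 0 < T := by linarith
  have hC := hg.growth_nonneg
  have hM := hg.rate_nonneg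
  have htI : t ∈ Icc 0 T := ⟨ht, by linarith⟩
  have htI' : t + τ ∈ Icc 0 T := ⟨by linarith, htT⟩
  have hexp : 1 ≤ Real.exp (M * τ) := Real.one_le_exp (by positivity)
  have hΛL : Λ ≤ L := (le_mul_of_one_le_right hΛ hexp).trans hL
  have hexpC : 1 ≤ Real.exp (2 * C * τ) := Real.one_le_exp (by positivity)
  obtain ⟨θ, hθ, hθeq, hθle⟩ := exists_contDiff_eq_sub (t + τ) hτ
  have hθ1 : θ (t + τ) = 0 := by
    rw [hθeq _ (by simpa using hτ)]; simp
  have hθ0 : θ t = τ := by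
    rw [hθeq _ (by rw [sub_add_cancel_left, abs_neg, abs_of_pos hτ]; linarith)]; simp
  set u : E × ℝ → ℝ := fun q => φ (q.1 + θ q.2 • g q) with hu_def
  have hu : ContDiff ℝ 1 u := by
    have : ContDiff ℝ 1 fun q : E × ℝ => θ q.2 := hθ.comp contDiff_snd
    exact hφ.contDiff.comp (contDiff_fst.add (this.smul hg.contDiff))
  have hQP : Q ≤ P := (le_mul_of_one_le_right hQ0 hexpC).trans hQ
  have hsupp : ∀ x s, 2 * P - 1 < ‖x‖ → u (x, s) = 0 := by
    intro x s hx
    refine hφ.eq_zero _ (lt_of_lt_of_le ?_ (hg.one_add_norm_mul_le x s (θ s)))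
    have : |θ s| * C ≤ 1 / 2 := (mul_le_mul_of_nonneg_right (hθle s) hC).trans hτC
    nlinarith [norm_nonneg x]
  have e1 := H.transportFlux_eq hT hu (by linarith) hsupp htI'
  have e0 := H.transportFlux_eq hT hu (by linarith) hsupp htI
  have eφ : (fun x => u (x, t + τ)) = φ := by
    ext x; simp [hu_def, hθ1]
  refine ⟨fun x => u (x, t), ?_, ?_⟩
  · simp only [hu_def, hθ0]
    exact hg.isTestFunction_step hΛ hφ ⟨hτ.le, hτδ⟩ (by nlinarith) hQ htI
  obtain ⟨B, hB0, hB⟩ := exists_norm_fderiv_le hu hsupp T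
  have hmeas := measurable_transportDeriv H.measurable_field hu
  have hbd : ∀ x, ∀ s ∈ Icc 0 T, |transportDeriv b u (x, s)| ≤ B * (1 + ‖b (x, s)‖) :=
    fun x s hs => abs_transportDeriv_le (hB x s hs)
  have hsigned := H.integrableOn_signedIntegral hmeas hbd
  rw [eφ] at e1
  rw [e1, e0]
  have hsplit : ∫ s in Icc 0 (t + τ), signedIntegral a c (transportDeriv b u) s =
      (∫ s in Icc 0 t, signedIntegral a c (transportDeriv b u) s) +
        ∫ s in Ioc t (t + τ), signedIntegral a c (transportDeriv b u) s := by
    rw [← Icc_union_Ioc_eq_Icc ht (by linarith : t ≤ t + τ)]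
    refine setIntegral_union ?_ measurableSet_Ioc
      (hsigned.mono_set (Icc_subset_Icc_right htI.2))
      (hsigned.mono_set fun s hs => ⟨ht.trans hs.1.le, hs.2.trans htT⟩)
    exact disjoint_left.2 fun s h1 h2 => absurd h2.1 (not_lt.2 h1.2)
  rw [hsplit, add_sub_cancel_left]
  refine (enorm_integral_le_lintegral_enorm _).trans (lintegral_mono_ae ?_)
  have hsub : Ioc t (t + τ) ⊆ Icc 0 T := fun s hs => ⟨ht.trans hs.1.le, hs.2.trans htT⟩
  filter_upwards [ae_restrict_of_ae_restrict_of_subset hsub (H.ae_enorm_signedIntegral_le hmeas hbd),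
    ae_restrict_mem measurableSet_Ioc] with s hs hst
  have hsT := hsub hst
  refine hs.trans ?_
  have hθs : θ s = t + τ - s := hθeq s (by
    rw [abs_sub_lt_iff]; constructor <;> linarith [hst.1, hst.2])
  have hθd : HasDerivAt θ (-1) s := by
    refine (((hasDerivAt_id s).const_sub (t + τ))).congr_of_eventuallyEq ?_
    have ho : IsOpen {r : ℝ | |r - (t + τ)| < 2 * τ} := isOpen_lt (by fun_prop) (by fun_prop)
    filter_upwards [ho.mem_nhds (show s ∈ _ by
      rw [mem_ofPred_eq, abs_sub_lt_iff]; constructor <;> linarith [hst.1, hst.2])] with r hr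
    exact hθeq r hr
  have hσ0 : 0 ≤ θ s := by rw [hθs]; linarith [hst.2]
  have hστ : θ s ≤ τ := by rw [hθs]; linarith [hst.1]
  have hσQ : Q * Real.exp (2 * C * θ s) ≤ P := by
    refine le_trans ?_ hQ
    gcongr
  have hσC : θ s * C ≤ 1 / 2 := by nlinarith
  have hpt : ∀ x, ‖transportDeriv b u (x, s)‖ₑ ≤
      ENNReal.ofReal L * ENNReal.ofReal (‖g (x, s) - b (x, s)‖ * √(V x)) +
        ENNReal.ofReal (τ * (L * K)) := by
    intro x
    have e : transportDeriv b u (x, s) =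
        fderiv ℝ φ (x + θ s • g (x, s))
          ((b (x, s) - g (x, s)) + θ s • fderiv ℝ g (x, s) (b (x, s) - g (x, s), 0)) +
        θ s * fderiv ℝ φ (x + θ s • g (x, s)) (fderiv ℝ g (x, s) (g (x, s), 1)) := by
      have hlin : fderiv ℝ g (x, s) (b (x, s), 1) =
          fderiv ℝ g (x, s) (b (x, s) - g (x, s), 0) + fderiv ℝ g (x, s) (g (x, s), 1) := by
        rw [← map_add]; simp
      rw [transportDeriv, IsEulerField.hasFDerivAt_comp_step hg.contDiff hφ.contDiff hθd, hlin]
      simp only [map_add, map_smul, map_sub, smul_eq_mul]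
      ring
    have h1 := hg.abs_fderiv_le hΛ hφ ⟨hσ0, hστ.trans hτδ⟩ hσC hσQ x hsT (b (x, s) - g (x, s))
    have h2 := hg.abs_fderiv_acceleration_le hΛ hK hφ hσ0 hσC hσQ x hsT
    have h3 : Λ * Real.exp (M * θ s) ≤ L := by
      refine le_trans ?_ hL
      gcongr
    rw [← ofReal_norm, ← ENNReal.ofReal_mul (hΛ.trans hΛL), ← ENNReal.ofReal_add
      (mul_nonneg (hΛ.trans hΛL) (by positivity)) (mul_nonneg hτ.le (mul_nonneg (hΛ.trans hΛL) hK))]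
    refine ENNReal.ofReal_le_ofReal ?_
    rw [e, norm_sub_rev (g (x, s))]
    refine (norm_add_le _ _).trans (add_le_add ?_ ?_)
    · rw [Real.norm_eq_abs]
      refine h1.trans ?_
      calc Λ * Real.exp (M * θ s) * √(V x) * ‖b (x, s) - g (x, s)‖
          ≤ L * √(V x) * ‖b (x, s) - g (x, s)‖ := by gcongr
        _ = _ := by ring
    · rw [norm_mul, Real.norm_eq_abs, Real.norm_eq_abs, abs_of_nonneg hσ0]
      have : Λ * K ≤ L * K := by gcongr
      exact mul_le_mul hστ (h2.trans this) (abs_nonneg _) hτ.le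
  refine (lintegral_mono hpt).trans ?_
  rw [lintegral_add_right _ measurable_const, lintegral_const_mul' _ _ ENNReal.ofReal_ne_top,
    lintegral_const]
  gcongr
  · exact le_rfl
  · exact tvDiff_le_add

lemma IsTransportPair.enorm_transportFlux_le_of_partition (H : IsTransportPair T (2 * P) b a c)
    (hg : IsEulerField T δ M C K P g V) (hK : 0 ≤ K) (hP : 0 < P)
    {Λ L Q τ : ℝ} (hΛ : 0 ≤ Λ) (hQ0 : 0 ≤ Q) (hτ : 0 < τ) (hτδ : τ ≤ δ)
    (hτC : 3 * τ * C ≤ 1 / 2) (hQ : Q * Real.exp (2 * C * T) ≤ P)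
    (hL : Λ * Real.exp (M * T) ≤ L) (j : ℕ) :
    ∀ r, 0 ≤ r → j * τ + r ≤ T → ∀ φ : E → ℝ,
      IsTestFunction V (Λ * Real.exp (M * r)) (Q * Real.exp (2 * C * r)) φ →
      ‖transportFlux a c b φ (j * τ)‖ₑ ≤
        ∫⁻ s in Icc 0 (j * τ), (ENNReal.ofReal L * fieldDist a c b g V s +
          ENNReal.ofReal (τ * (L * K)) * (a s + c s) univ) := by
  have hC := hg.growth_nonneg
  have hM := hg.rate_nonneg
  induction j with
  | zero =>
    intro r _ _ φ _
    simp [transportFlux]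
  | succ j ih =>
    intro r hr hrT φ hφ
    push_cast at hrT ⊢
    have hj : (0 : ℝ) ≤ j * τ := by positivity
    have es : ((j : ℝ) + 1) * τ = j * τ + τ := by ring
    have e1 : ∀ A D : ℝ, A * Real.exp (D * r) * Real.exp (D * τ) = A * Real.exp (D * (r + τ)) := by
      intro A D
      rw [mul_assoc, ← Real.exp_add, mul_add]
    rw [es] at hrT ⊢
    obtain ⟨φ', hφ', hle⟩ := H.exists_euler_step hg hK hP (t := j * τ) (τ := τ) (L := L)
      (by positivity) hφ hj (by linarith) hτ hτδ hτC
      (by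
        rw [e1]; refine le_trans ?_ hQ
        gcongr; linarith) (by positivity)
      (by
        rw [e1]; refine le_trans ?_ hL
        gcongr; linarith)
    rw [e1, e1] at hφ'
    have h1 := ih (r + τ) (by linarith) (by linarith) φ' hφ'
    calc ‖transportFlux a c b φ (j * τ + τ)‖ₑ
        = ‖transportFlux a c b φ' (j * τ) +
            (transportFlux a c b φ (j * τ + τ) - transportFlux a c b φ' (j * τ))‖ₑ := by
          rw [add_sub_cancel]
      _ ≤ _ := (enorm_add_le _ _).trans (add_le_add h1 hle)
      _ = _ := by
          rw [← Icc_union_Ioc_eq_Icc hj (by linarith : (j : ℝ) * τ ≤ j * τ + τ),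
            lintegral_union measurableSet_Ioc
              (disjoint_left.2 fun s h1 h2 => absurd h2.1 (not_lt.2 h1.2))]
          rfl

lemma IsTransportPair.enorm_transportFlux_le (H : IsTransportPair T (2 * P) b a c)
    (hg : IsEulerField T δ M C K P g V) (hδ : 0 < δ) (hK : 0 ≤ K) (hP : 0 < P)
    {Λ Q s : ℝ} (hΛ : 0 ≤ Λ) (hQ0 : 0 ≤ Q) (hQ : Q * Real.exp (2 * C * T) ≤ P)
    (hs : s ∈ Icc 0 T) {φ : E → ℝ} (hφ : IsTestFunction V Λ Q φ) :
    ‖transportFlux a c b φ s‖ₑ ≤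
      ENNReal.ofReal (Λ * Real.exp (M * T)) * ∫⁻ r in Icc 0 T, fieldDist a c b g V r := by
  rcases hs.1.eq_or_lt with rfl | hs0
  · simp [transportFlux]
  set L := Λ * Real.exp (M * T)
  set I := ∫⁻ r in Icc 0 T, fieldDist a c b g V r
  set m := ∫⁻ r in Icc 0 T, (a r + c r) univ
  have hm : m ≠ ⊤ := H.mass_lt_top.ne
  have hmm : Measurable fun s => (a s + c s) univ := by
    simpa using H.measurable_lintegral (f := fun _ => 1) measurable_const
  have hlim0 : Tendsto (fun N : ℕ => s / N) atTop (𝓝 0) := tendsto_const_div_atTop_nhds_zero_nat s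
  have hlim : Tendsto (fun N : ℕ => ENNReal.ofReal L * I + ENNReal.ofReal (s / N * (L * K)) * m)
      atTop (𝓝 (ENNReal.ofReal L * I + ENNReal.ofReal (0 * (L * K)) * m)) := by
    refine tendsto_const_nhds.add (ENNReal.Tendsto.mul_const ?_ (Or.inr hm))
    exact ENNReal.tendsto_ofReal (hlim0.mul_const _)
  simp only [zero_mul, ENNReal.ofReal_zero, add_zero] at hlim
  refine ge_of_tendsto hlim ?_
  have hlim3 : Tendsto (fun N : ℕ => 3 * (s / N) * C) atTop (𝓝 (3 * 0 * C)) :=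
    (hlim0.const_mul 3).mul_const C
  filter_upwards [eventually_gt_atTop 0, hlim0.eventually (gt_mem_nhds hδ),
    hlim3.eventually (gt_mem_nhds (show 3 * 0 * C < 1 / 2 by norm_num))] with N hN h1 h2
  have hN' : (0 : ℝ) < N := by exact_mod_cast hN
  have hNs : (N : ℝ) * (s / N) = s := by field_simp
  have := H.enorm_transportFlux_le_of_partition hg hK hP hΛ hQ0 (τ := s / N) (by positivity) h1.le
    h2.le hQ (le_refl L) N 0 le_rfl (by rw [hNs]; simpa using hs.2) φ (by simpa using hφ)
  rw [hNs] at this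
  refine this.trans ((lintegral_mono_set (Icc_subset_Icc_right hs.2)).trans_eq ?_)
  rw [lintegral_add_right _ (hmm.const_mul _), lintegral_const_mul' _ _ ENNReal.ofReal_ne_top,
    lintegral_const_mul' _ _ ENNReal.ofReal_ne_top]

end Iteration

section Approximation

variable {E : Type*} [NormedAddCommGroup E] [InnerProductSpace ℝ E] [FiniteDimensional ℝ E]

lemma exists_isEulerField {g : E → ℝ → E} (hg : ContDiff ℝ 1 fun q : E × ℝ => g q.1 q.2)
    {V : E → ℝ} (hV : ContDiff ℝ 1 V) (hVpos : ∀ x, 0 < V x) {P T C C' : ℝ} (hC : 0 ≤ C)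
    (hC' : 0 ≤ C') (hgC : ∀ x t, ‖g x t‖ ≤ C + C * ‖x‖)
    (h : ∀ x ∈ closedBall (0 : E) P, ∀ t ∈ Icc (0 : ℝ) T, ∀ ξ : E, ‖ξ‖ = 1 →
      ⟪g x t, gradient V x⟫ ≤ (C' - 2 * ⟪fderiv ℝ (fun y => g y t) x ξ, ξ⟫) * V x) :
    ∃ δ > 0, ∃ K ≥ 0, IsEulerField T δ (C' + 1) C K P (fun q : E × ℝ => g q.1 q.2) V := by
  set G : E × ℝ → E := fun q => g q.1 q.2 with hG
  have hslice : ∀ x t (ξ : E), fderiv ℝ (fun y => g y t) x ξ = fderiv ℝ G (x, t) (ξ, 0) := by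
    intro x t ξ
    have h1 : HasFDerivAt (fun y : E => (y, t)) ((ContinuousLinearMap.id ℝ E).prod 0) x :=
      (hasFDerivAt_id x).prodMk (hasFDerivAt_const t x)
    have h2 := ((hg.differentiable (by norm_num) (x, t)).hasFDerivAt.comp x h1).fderiv
    rw [show ((fun q : E × ℝ => g q.1 q.2) ∘ fun y : E => (y, t)) = fun y => g y t from rfl] at h2
    rw [h2]
    simp [hG]
  obtain ⟨δ, hδ, hdist⟩ := exists_norm_sq_mul_le_of_euler_step hg hV hVpos (R := P) (T := T)
    (C := C') (fun x hx t ht ξ hξ => by rw [← hG, ← hslice]; exact h x hx t ht ξ hξ)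
  have hcont : Continuous fun p : E × (E × ℝ) =>
      √(V p.1) * ‖fderiv ℝ G p.2 (G p.2, 1)‖ := by
    have h1 : Continuous (fderiv ℝ G) := hg.continuous_fderiv (by norm_num)
    have h2 : Continuous G := hg.continuous
    have h3 : Continuous V := hV.continuous
    have h4 : Continuous fun p : E × (E × ℝ) => fderiv ℝ G p.2 (G p.2, 1) :=
      (h1.comp (by fun_prop)).clm_apply (by fun_prop)
    fun_prop
  obtain ⟨K, hK⟩ := ((isCompact_closedBall (0 : E) P).prod
    ((isCompact_closedBall (0 : E) P).prod (isCompact_Icc (a := 0) (b := T)))).exists_bound_of_continuousOn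
      hcont.continuousOn
  refine ⟨δ, hδ, max K 0, le_max_right _ _, hg, hC, by linarith, fun q => hgC q.1 q.2, ?_, ?_⟩
  · intro x hx t ht τ hτ ξ
    refine le_of_sq_le_sq ?_ (by positivity)
    rw [mul_pow, mul_pow, mul_pow, Real.sq_sqrt (hVpos _).le, Real.sq_sqrt (hVpos _).le,
      ← Real.exp_nat_mul]
    refine (hdist x hx t ht τ hτ ξ).trans ?_
    have h1 := Real.add_one_le_exp ((2 : ℕ) * ((C' + 1) * τ))
    have h2 : 0 ≤ (C' + 1) * τ := mul_nonneg (by linarith) hτ.1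
    have h3 := (hVpos x).le
    gcongr
    push_cast at h1 ⊢
    linarith
  · intro x hx y hy t ht
    exact ((le_abs_self _).trans (hK (y, (x, t)) ⟨hy, hx, ht⟩)).trans (le_max_left _ _)

omit [FiniteDimensional ℝ E] in
lemma isTestFunction_of_norm_fderiv_le {φ V : E → ℝ} (hφ : ContDiff ℝ 1 φ) {r B v : ℝ}
    (hr : ∀ x, r < ‖x‖ → φ x = 0) (hB : ∀ x, ‖fderiv ℝ φ x‖ ≤ B) (hv : 0 < v)
    (hV : ∀ x, ‖x‖ ≤ r → v ≤ V x) : IsTestFunction V (B / √v) (1 + r) φ where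
  contDiff := hφ
  eq_zero x hx := hr x (by linarith)
  abs_fderiv_le x ξ := by
    have hB0 : 0 ≤ B := (norm_nonneg _).trans (hB x)
    by_cases hx : ‖x‖ ≤ r
    · have h1 : √v ≤ √(V x) := Real.sqrt_le_sqrt (hV x hx)
      have h2 : 0 < √v := Real.sqrt_pos.2 hv
      calc |fderiv ℝ φ x ξ| ≤ B * ‖ξ‖ := (fderiv ℝ φ x).le_of_opNorm_le (hB x) ξ
        _ = B / √v * √v * ‖ξ‖ := by field_simp
        _ ≤ _ := by gcongr
    · have ho : IsOpen {y : E | r < ‖y‖} := isOpen_lt (by fun_prop) (by fun_prop)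
      have : φ =ᶠ[𝓝 x] fun _ => 0 := by
        filter_upwards [ho.mem_nhds (show x ∈ _ from not_le.1 hx)] with y hy using hr y hy
      rw [this.fderiv_eq, fderiv_const_apply]
      simp only [_root_.zero_apply, abs_zero]
      positivity

variable [MeasurableSpace E] [BorelSpace E]

lemma IsKernelPair.lintegral_fieldDist_eq {T R : ℝ} {b g : E × ℝ → E} {V : E → ℝ}
    {a c : Kernel ℝ E} (H : IsKernelPair T b a c) (hg : Continuous g) (hV : Continuous V)
    (ha : ∀ s, (a s) (closedBall 0 R)ᶜ = 0) (hc : ∀ s, (c s) (closedBall 0 R)ᶜ = 0) :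
    ∫⁻ s in Icc 0 T, fieldDist a c b g V s = ENNReal.ofReal
      (∫ s in Icc 0 T, ∫ x, ‖g (x, s) - b (x, s)‖ * √(V x) ∂(tvDiff (a s) (c s))) := by
  obtain ⟨ζ, hζ, hζe⟩ := exists_kernel_tvDiff a c H.finite_left H.finite_right
  have hfm : Measurable fun q : E × ℝ => ‖g q - b q‖ * √(V q.1) :=
    (hg.measurable.sub H.measurable_field).norm.mul
      (Real.continuous_sqrt.measurable.comp (hV.measurable.comp measurable_fst))
  have hF : Measurable (fieldDist a c b g V) := by
    have e : fieldDist a c b g V = fun s =>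
        ∫⁻ x, ENNReal.ofReal (‖g (x, s) - b (x, s)‖ * √(V x)) ∂(ζ s) := by
      ext s
      rw [hζe, fieldDist]
    rw [e]
    exact Measurable.lintegral_kernel_prod_right
      (f := fun s x => ENNReal.ofReal (‖g (x, s) - b (x, s)‖ * √(V x)))
      (hfm.ennreal_ofReal.comp measurable_swap)
  obtain ⟨K₁, hK₁⟩ := ((isCompact_closedBall (0 : E) R).prod
    (isCompact_Icc (a := 0) (b := T))).exists_bound_of_continuousOn hg.continuousOn
  obtain ⟨K₂, hK₂⟩ := (isCompact_closedBall (0 : E) R).exists_bound_of_continuousOn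
    (hV.sqrt).continuousOn
  set K := (max K₁ 1) * max K₂ 0
  have hbd : ∀ x ∈ closedBall (0 : E) R, ∀ s ∈ Icc 0 T,
      ‖g (x, s) - b (x, s)‖ * √(V x) ≤ K * (1 + ‖b (x, s)‖) := by
    intro x hx s hs
    have h1 : ‖g (x, s)‖ ≤ max K₁ 1 := (hK₁ (x, s) ⟨hx, hs⟩).trans (le_max_left _ _)
    have h2 : √(V x) ≤ max K₂ 0 := (le_abs_self _).trans ((hK₂ x hx).trans (le_max_left _ _))
    have h3 : ‖g (x, s) - b (x, s)‖ ≤ max K₁ 1 * (1 + ‖b (x, s)‖) := by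
      refine (norm_sub_le _ _).trans ?_
      nlinarith [norm_nonneg (b (x, s)), le_max_right K₁ 1]
    calc ‖g (x, s) - b (x, s)‖ * √(V x) ≤ (max K₁ 1 * (1 + ‖b (x, s)‖)) * max K₂ 0 :=
          mul_le_mul h3 h2 (Real.sqrt_nonneg _) ((norm_nonneg _).trans h3)
      _ = _ := by ring
  have hfin : ∫⁻ s in Icc 0 T, fieldDist a c b g V s < ⊤ := by
    refine lt_of_le_of_lt (setLIntegral_mono' measurableSet_Icc fun s hs => ?_)
      (H.lintegral_one_add_lt_top K)
    refine (lintegral_mono' tvDiff_le_add le_rfl).trans (lintegral_mono_ae ?_)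
    have hae : ∀ᵐ x ∂(a s + c s), x ∈ closedBall (0 : E) R := by
      rw [ae_iff]
      change (a s + c s) (closedBall 0 R)ᶜ = 0
      rw [Measure.add_apply, ha, hc, add_zero]
    filter_upwards [hae] with x hx
    exact ENNReal.ofReal_le_ofReal (hbd x hx s hs)
  have hin : ∀ s, ∫ x, ‖g (x, s) - b (x, s)‖ * √(V x) ∂(tvDiff (a s) (c s)) =
      (fieldDist a c b g V s).toReal := fun s =>
    integral_eq_lintegral_of_nonneg_ae (Eventually.of_forall fun x => by positivity)
      (hfm.comp measurable_prodMk_right).aestronglyMeasurable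
  simp_rw [hin]
  rw [integral_toReal hF.aemeasurable (ae_lt_top hF hfin.ne), ENNReal.ofReal_toReal hfin.ne]

/-- If `b` is approximated by fields `g k` whose Euler steps are controlled by the weights `V k`,
the flux of the difference of two solutions vanishes. -/
lemma IsTransportPair.transportFlux_eq_zero {T P M C B v r s : ℝ} {b : E × ℝ → E}
    {a c : Kernel ℝ E} (H : IsTransportPair T (2 * P) b a c) (hP : 0 < P)
    (ha : ∀ s, (a s) (closedBall 0 (2 * P))ᶜ = 0) (hc : ∀ s, (c s) (closedBall 0 (2 * P))ᶜ = 0)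
    {δ K : ℕ → ℝ} {g : ℕ → E × ℝ → E} {V : ℕ → E → ℝ}
    (hδ : ∀ k, 0 < δ k) (hK : ∀ k, 0 ≤ K k)
    (hg : ∀ k, IsEulerField T (δ k) M C (K k) P (g k) (V k)) (hV : ∀ k, Continuous (V k))
    (hlim : Tendsto (fun k => ∫ s in Icc 0 T, ∫ x, ‖g k (x, s) - b (x, s)‖ * √(V k x)
      ∂(tvDiff (a s) (c s))) atTop (𝓝 0))
    {φ : E → ℝ} (hφ : ContDiff ℝ 1 φ) (hr0 : 0 ≤ r) (hr : ∀ x, r < ‖x‖ → φ x = 0)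
    (hB : ∀ x, ‖fderiv ℝ φ x‖ ≤ B) (hv : 0 < v) (hVv : ∀ k x, ‖x‖ ≤ r → v ≤ V k x)
    (hrP : (1 + r) * Real.exp (2 * C * T) ≤ P) (hs : s ∈ Icc 0 T) :
    transportFlux a c b φ s = 0 := by
  have hB0 : 0 ≤ B := (norm_nonneg _).trans (hB 0)
  have hle : ∀ k, ‖transportFlux a c b φ s‖ₑ ≤ ENNReal.ofReal (B / √v * Real.exp (M * T)) *
      ENNReal.ofReal (∫ s in Icc 0 T, ∫ x, ‖g k (x, s) - b (x, s)‖ * √(V k x)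
        ∂(tvDiff (a s) (c s))) := by
    intro k
    rw [← H.lintegral_fieldDist_eq (hg k).contDiff.continuous (hV k) ha hc]
    exact H.enorm_transportFlux_le (hg k) (hδ k) (hK k) hP (by positivity) (by positivity) hrP hs
      (isTestFunction_of_norm_fderiv_le hφ hr hB hv (hVv k))
  have h0 : Tendsto (fun k => ENNReal.ofReal (B / √v * Real.exp (M * T)) *
      ENNReal.ofReal (∫ s in Icc 0 T, ∫ x, ‖g k (x, s) - b (x, s)‖ * √(V k x)
        ∂(tvDiff (a s) (c s)))) atTop
      (𝓝 (ENNReal.ofReal (B / √v * Real.exp (M * T)) * ENNReal.ofReal 0)) :=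
    ENNReal.Tendsto.const_mul (ENNReal.tendsto_ofReal hlim) (Or.inr ENNReal.ofReal_ne_top)
  rw [ENNReal.ofReal_zero, mul_zero] at h0
  exact enorm_eq_zero.1 (le_antisymm (ge_of_tendsto' h0 hle) zero_le)

end Approximation

section KernelPairs

variable {E : Type*} [NormedAddCommGroup E] [InnerProductSpace ℝ E] [FiniteDimensional ℝ E]
  [MeasurableSpace E] [BorelSpace E]

namespace IsKernelPair

variable {T : ℝ} {b : E × ℝ → E} {a₁ c₁ a₂ c₂ : Kernel ℝ E}

lemma sub (H₁ : IsKernelPair T b a₁ c₁) (H₂ : IsKernelPair T b a₂ c₂) :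
    IsKernelPair T b (a₁ + c₂) (a₂ + c₁) where
  finite_left t := by
    have := H₁.finite_left t
    have := H₂.finite_right t
    rw [_root_.add_apply]
    infer_instance
  finite_right t := by
    have := H₂.finite_left t
    have := H₁.finite_right t
    rw [_root_.add_apply]
    infer_instance
  measurable_field := H₁.measurable_field
  mass_lt_top := by
    have e : ∀ s, ((a₁ + c₂) s + (a₂ + c₁) s) univ =
        (a₁ s + c₁ s) univ + (a₂ s + c₂ s) univ := fun s => by
      simp only [_root_.add_apply, Measure.add_apply]
      ring
    have hm : Measurable fun s => (a₁ s + c₁ s) univ := by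
      simpa using H₁.measurable_lintegral (f := fun _ => 1) measurable_const
    simp_rw [e]
    rw [lintegral_add_left hm]
    exact ENNReal.add_lt_top.2 ⟨H₁.mass_lt_top, H₂.mass_lt_top⟩
  field_lt_top := by
    have e : ∀ s, ∫⁻ x, ‖b (x, s)‖ₑ ∂((a₁ + c₂) s + (a₂ + c₁) s) =
        ∫⁻ x, ‖b (x, s)‖ₑ ∂(a₁ s + c₁ s) + ∫⁻ x, ‖b (x, s)‖ₑ ∂(a₂ s + c₂ s) := fun s => by
      simp only [_root_.add_apply, lintegral_add_measure]
      ring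
    simp_rw [e]
    rw [lintegral_add_left (H₁.measurable_lintegral H₁.measurable_field.enorm)]
    exact ENNReal.add_lt_top.2 ⟨H₁.field_lt_top, H₂.field_lt_top⟩

lemma ae_signedIntegral_sub (H₁ : IsKernelPair T b a₁ c₁) (H₂ : IsKernelPair T b a₂ c₂)
    {h : E × ℝ → ℝ} (hh : Measurable h) {K : ℝ}
    (hK : ∀ x, ∀ s ∈ Icc 0 T, |h (x, s)| ≤ K * (1 + ‖b (x, s)‖)) :
    ∀ᵐ s ∂(volume.restrict (Icc 0 T)), signedIntegral (a₁ + c₂) (a₂ + c₁) h s =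
      signedIntegral a₁ c₁ h s - signedIntegral a₂ c₂ h s := by
  filter_upwards [H₁.ae_integrable hh hK, H₂.ae_integrable hh hK] with s h1 h2
  simp only [signedIntegral, _root_.add_apply]
  rw [integral_add_measure h1.left_of_add_measure h2.right_of_add_measure,
    integral_add_measure h2.left_of_add_measure h1.right_of_add_measure]
  ring

end IsKernelPair

/-- The kernel obtained by restricting a measurable family of locally finite measures to the
time interval `[0, T]` and the ball of radius `R`. -/
def familyKernel (T R : ℝ) (p : ℝ → Measure E)
    (hp : ∀ B, MeasurableSet B → Bornology.IsBounded B → Measurable fun t => p t B) :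
    Kernel ℝ E where
  toFun := (Icc 0 T).indicator fun t => (p t).restrict (ball 0 R)
  measurable' := by
    refine Measurable.indicator ?_ measurableSet_Icc
    refine Measure.measurable_of_measurable_coe _ fun s hs => ?_
    simp only [Measure.restrict_apply hs]
    exact hp _ (hs.inter measurableSet_ball) (isBounded_ball.subset inter_subset_right)

lemma familyKernel_apply {T R : ℝ} {p : ℝ → Measure E}
    (hp : ∀ B, MeasurableSet B → Bornology.IsBounded B → Measurable fun t => p t B) {t : ℝ}
    (ht : t ∈ Icc 0 T) : familyKernel T R p hp t = (p t).restrict (ball 0 R) :=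
  indicator_of_mem ht fun t => (p t).restrict (ball 0 R)

lemma familyKernel_apply_of_notMem {T R : ℝ} {p : ℝ → Measure E}
    (hp : ∀ B, MeasurableSet B → Bornology.IsBounded B → Measurable fun t => p t B) {t : ℝ}
    (ht : t ∉ Icc 0 T) : familyKernel T R p hp t = 0 :=
  indicator_of_notMem ht fun t => (p t).restrict (ball 0 R)

lemma familyKernel_apply_compl {T R : ℝ} {p : ℝ → Measure E}
    (hp : ∀ B, MeasurableSet B → Bornology.IsBounded B → Measurable fun t => p t B) (t : ℝ) :
    familyKernel T R p hp t (closedBall 0 R)ᶜ = 0 := by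
  by_cases ht : t ∈ Icc 0 T
  · rw [familyKernel_apply hp ht, Measure.restrict_apply measurableSet_closedBall.compl]
    have : (closedBall (0 : E) R)ᶜ ∩ ball 0 R = ∅ :=
      eq_empty_of_forall_notMem fun x hx => hx.1 (ball_subset_closedBall hx.2)
    rw [this, measure_empty]
  · simp [familyKernel_apply_of_notMem hp ht]

end KernelPairs

section Solutions

variable {d : ℕ} {T R : ℝ} {b : EuclideanSpace ℝ (Fin d) → ℝ → EuclideanSpace ℝ (Fin d)}
  {p n p₁ n₁ p₂ n₂ : ℝ → Measure (EuclideanSpace ℝ (Fin d))}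
  {νp νn : Measure (EuclideanSpace ℝ (Fin d))}

lemma IsLocFamily.measurable_left (h : IsLocFamily T p n) (B : Set (EuclideanSpace ℝ (Fin d)))
    (hB : MeasurableSet B) (hb : Bornology.IsBounded B) : Measurable fun t => p t B :=
  (h.2.2.1 B hB hb).1

lemma IsLocFamily.measurable_right (h : IsLocFamily T p n) (B : Set (EuclideanSpace ℝ (Fin d)))
    (hB : MeasurableSet B) (hb : Bornology.IsBounded B) : Measurable fun t => n t B :=
  (h.2.2.1 B hB hb).2

lemma IsLocFamily.isKernelPair (h : IsLocFamily T p n)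
    (hb : Measurable (fun q : EuclideanSpace ℝ (Fin d) × ℝ => b q.1 q.2)) 
    (hbi : ∫⁻ t in Icc (0:ℝ) T,
        ∫⁻ x in ball 0 R, ENNReal.ofReal ‖b x t‖ ∂(p t + n t) < ⊤) :
    IsKernelPair T (fun q => b q.1 q.2) (familyKernel T R p h.measurable_left)
      (familyKernel T R n h.measurable_right) where
  finite_left t := by
    by_cases ht : t ∈ Icc 0 T
    · rw [familyKernel_apply _ ht, isFiniteMeasure_restrict]
      exact ((measure_mono ball_subset_closedBall).trans_lt
        (h.1 t ht _ (isCompact_closedBall 0 R)).1).ne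
    · rw [familyKernel_apply_of_notMem _ ht]; infer_instance
  finite_right t := by
    by_cases ht : t ∈ Icc 0 T
    · rw [familyKernel_apply _ ht, isFiniteMeasure_restrict]
      exact ((measure_mono ball_subset_closedBall).trans_lt
        (h.1 t ht _ (isCompact_closedBall 0 R)).2).ne
    · rw [familyKernel_apply_of_notMem _ ht]; infer_instance
  measurable_field := hb
  mass_lt_top := by
    refine lt_of_le_of_lt (setLIntegral_mono' measurableSet_Icc fun s hs => ?_)
      (h.2.2.2 _ (isCompact_closedBall 0 R)).2
    obtain ⟨h1, h2⟩ := h.1 s hs _ (isCompact_closedBall 0 R)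
    rw [← ofReal_norm, Real.norm_of_nonneg (by positivity),
      ENNReal.ofReal_add ENNReal.toReal_nonneg ENNReal.toReal_nonneg,
      ENNReal.ofReal_toReal h1.ne, ENNReal.ofReal_toReal h2.ne,
      familyKernel_apply _ hs, familyKernel_apply _ hs, Measure.add_apply,
      Measure.restrict_apply_univ, Measure.restrict_apply_univ]
    exact add_le_add (measure_mono ball_subset_closedBall) (measure_mono ball_subset_closedBall)
  field_lt_top := by
    refine lt_of_eq_of_lt (setLIntegral_congr_fun measurableSet_Icc fun s hs => ?_) hbi
    simp only [familyKernel_apply _ hs, ← Measure.restrict_add, ofReal_norm]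

lemma sint_eq_signedIntegral
    (hp : ∀ B, MeasurableSet B → Bornology.IsBounded B → Measurable fun t => p t B)
    (hn : ∀ B, MeasurableSet B → Bornology.IsBounded B → Measurable fun t => n t B)
    {h : EuclideanSpace ℝ (Fin d) × ℝ → ℝ} {s : ℝ} (hs : s ∈ Icc 0 T)
    (hR : ∀ x, R ≤ ‖x‖ → h (x, s) = 0) :
    sint p n s (fun x => h (x, s)) =
      signedIntegral (familyKernel T R p hp) (familyKernel T R n hn) h s := by
  have hx : ∀ x ∉ ball (0 : EuclideanSpace ℝ (Fin d)) R, h (x, s) = 0 := fun x hx =>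
    hR x (by simpa using hx)
  rw [sint, signedIntegral, familyKernel_apply _ hs, familyKernel_apply _ hs,
    setIntegral_eq_integral_of_forall_compl_eq_zero hx,
    setIntegral_eq_integral_of_forall_compl_eq_zero hx]

lemma transportDeriv_eq {E : Type*} [NormedAddCommGroup E] [InnerProductSpace ℝ E]
    [CompleteSpace E] {u : E × ℝ → ℝ} (hu : ContDiff ℝ 1 u) (b : E → ℝ → E) (x : E) (s : ℝ) :
    deriv (fun t => u (x, t)) s + ⟪b x s, gradient (fun y => u (y, s)) x⟫ =
      transportDeriv (fun q => b q.1 q.2) u (x, s) := by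
  have hd := (hu.differentiable (by norm_num) (x, s)).hasFDerivAt
  have h1 : HasDerivAt (fun t : ℝ => u (x, t)) (fderiv ℝ u (x, s) (0, 1)) s :=
    hd.comp_hasDerivAt s ((hasDerivAt_const s x).prodMk (hasDerivAt_id s))
  have h2 : HasFDerivAt (fun y : E => u (y, s))
      ((fderiv ℝ u (x, s)).comp ((ContinuousLinearMap.id ℝ E).prod 0)) x :=
    hd.comp x ((hasFDerivAt_id x).prodMk (hasFDerivAt_const s x))
  rw [h1.deriv, gradient, h2.fderiv, real_inner_comm, InnerProductSpace.toDual_symm_apply,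
    transportDeriv]
  simp only [ContinuousLinearMap.comp_apply, ContinuousLinearMap.prod_apply,
    ContinuousLinearMap.id_apply, _root_.zero_apply]
  rw [← map_add]
  simp

lemma IsSolution.isTransportPair (hfam₁ : IsLocFamily T p₁ n₁) (hfam₂ : IsLocFamily T p₂ n₂)
    (hsol₁ : IsSolution T b νp νn p₁ n₁) (hsol₂ : IsSolution T b νp νn p₂ n₂)
    (hb : Measurable (fun q : EuclideanSpace ℝ (Fin d) × ℝ => b q.1 q.2)) (hR : 0 < R) :
    IsTransportPair T R (fun q => b q.1 q.2)
      (familyKernel T R p₁ hfam₁.measurable_left + familyKernel T R n₂ hfam₂.measurable_right)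
      (familyKernel T R p₂ hfam₂.measurable_left + familyKernel T R n₁ hfam₁.measurable_right) := by
  have H₁ := hfam₁.isKernelPair hb (hsol₁.1 0 R hR)
  have H₂ := hfam₂.isKernelPair hb (hsol₂.1 0 R hR)
  refine ⟨H₁.sub H₂, fun u hu ρ hρR hρ => ?_⟩
  obtain ⟨K, hK0, hK⟩ := exists_norm_fderiv_le hu hρ T
  have hTm := measurable_transportDeriv hb hu
  have hTK : ∀ x, ∀ s ∈ Icc 0 T, |transportDeriv (fun q => b q.1 q.2) u (x, s)| ≤
      K * (1 + ‖b x s‖) := fun x s hs => abs_transportDeriv_le (hK x s hs)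
  have hTz : ∀ s x, R ≤ ‖x‖ → transportDeriv (fun q => b q.1 q.2) u (x, s) = 0 := by
    intro s x hx
    have : u =ᶠ[𝓝 (x, s)] fun _ => 0 := by
      have ho : IsOpen {q : EuclideanSpace ℝ (Fin d) × ℝ | ρ < ‖q.1‖} :=
        isOpen_lt (by fun_prop) (by fun_prop)
      filter_upwards [ho.mem_nhds (show (x, s) ∈ _ from hρR.trans_le hx)] with q hq
      exact hρ q.1 q.2 hq
    rw [transportDeriv, this.fderiv_eq, fderiv_const_apply, _root_.zero_apply]
  obtain ⟨K', hK'⟩ : ∃ K', ∀ x, ∀ s ∈ Icc 0 T, |u (x, s)| ≤ K' * (1 + ‖b x s‖) := by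
    obtain ⟨K', hK'⟩ := ((isCompact_closedBall (0 : EuclideanSpace ℝ (Fin d)) ρ).prod
      (isCompact_Icc (a := 0) (b := T))).exists_bound_of_continuousOn hu.continuous.continuousOn
    refine ⟨max K' 0, fun x s hs => ?_⟩
    have : |u (x, s)| ≤ max K' 0 := by
      by_cases hx : ‖x‖ ≤ ρ
      · exact (hK' (x, s) ⟨by simpa using hx, hs⟩).trans (le_max_left _ _)
      · rw [hρ x s (not_le.1 hx), abs_zero]; exact le_max_right _ _
    nlinarith [norm_nonneg (b x s), le_max_right K' 0]
  have hsupp : ∃ r > 0, ∀ x t, r < ‖x‖ → u (x, t) = 0 :=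
    ⟨max ρ 1, by positivity, fun x t hx => hρ x t ((le_max_left _ _).trans_lt hx)⟩
  filter_upwards [hsol₁.2 (fun x t => u (x, t)) hu hsupp, hsol₂.2 (fun x t => u (x, t)) hu hsupp,
    H₁.ae_signedIntegral_sub H₂ hu.continuous.measurable hK', ae_restrict_mem measurableSet_Icc]
    with t h1 h2 h3 ht
  have hsub : Icc 0 t ⊆ Icc 0 T := Icc_subset_Icc_right ht.2
  rw [h3, ← sint_eq_signedIntegral _ _ ht fun x hx => hρ x t (hρR.trans_le hx),
    ← sint_eq_signedIntegral _ _ ht fun x hx => hρ x t (hρR.trans_le hx), h1, h2,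
    add_sub_add_left_eq_sub]
  simp only [transportDeriv_eq hu]
  rw [← integral_sub]
  · refine integral_congr_ae ?_
    filter_upwards [ae_restrict_of_ae_restrict_of_subset hsub (H₁.ae_signedIntegral_sub H₂ hTm hTK),
      ae_restrict_mem measurableSet_Icc] with s hs hst
    rw [hs, sint_eq_signedIntegral _ _ (hsub hst) (hTz s),
      sint_eq_signedIntegral _ _ (hsub hst) (hTz s)]
  · refine IntegrableOn.congr_fun ((H₁.integrableOn_signedIntegral hTm hTK).mono_set hsub)
      (fun s hs => ?_) measurableSet_Icc
    exact (sint_eq_signedIntegral _ _ (hsub hs) (hTz s)).symm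
  · refine IntegrableOn.congr_fun ((H₂.integrableOn_signedIntegral hTm hTK).mono_set hsub)
      (fun s hs => ?_) measurableSet_Icc
    exact (sint_eq_signedIntegral _ _ (hsub hs) (hTz s)).symm

end Solutions

section Determining

lemma exists_countable_isPiSystem_isOpen (E : Type*) [TopologicalSpace E]
    [SecondCountableTopology E] [mE : MeasurableSpace E] [BorelSpace E] :
    ∃ D : Set (Set E), D.Countable ∧ IsPiSystem D ∧ (∀ O ∈ D, IsOpen O) ∧ univ ∈ D ∧
      mE = MeasurableSpace.generateFrom D := by
  let S := TopologicalSpace.countableBasis E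
  let F : Set (Set (Set E)) := {s | s.Finite ∧ s ⊆ S}
  have hS := TopologicalSpace.isBasis_countableBasis E
  have hopen : ∀ O ∈ sInter '' F, IsOpen O := by
    rintro _ ⟨s, hs, rfl⟩
    exact hs.1.isOpen_sInter fun t ht => hS.isOpen (hs.2 ht)
  refine ⟨sInter '' F, ?_, ?_, hopen, ⟨∅, ⟨finite_empty, empty_subset _⟩, sInter_empty⟩, ?_⟩
  · exact (Set.countable_ofPred_finite_subset (TopologicalSpace.countable_countableBasis E)).image _
  · rintro _ ⟨s, hs, rfl⟩ _ ⟨t, ht, rfl⟩ -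
    exact ⟨s ∪ t, ⟨hs.1.union ht.1, union_subset hs.2 ht.2⟩, sInter_union _ _⟩
  · refine le_antisymm ?_ (MeasurableSpace.generateFrom_le fun O hO => (hopen O hO).measurableSet)
    rw [BorelSpace.measurable_eq (α := E), hS.borel_eq_generateFrom]
    exact MeasurableSpace.generateFrom_mono fun O hO =>
      ⟨{O}, ⟨finite_singleton O, singleton_subset_iff.2 hO⟩, sInter_singleton O⟩

variable {E : Type*} [NormedAddCommGroup E] [InnerProductSpace ℝ E] [FiniteDimensional ℝ E]
  [MeasurableSpace E] [BorelSpace E] {A B : ℝ → Measure E} {μ : Measure ℝ}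

/-- Families of measures with the same integrals of `C¹` functions supported in a closed ball
agree almost everywhere on open subsets of the ball. -/
lemma ae_measure_eq_of_isOpen
    (hfin : ∀ᵐ t ∂μ, ∀ K : Set E, IsCompact K → A t K < ⊤ ∧ B t K < ⊤)
    (h : ∀ φ : E → ℝ, ContDiff ℝ 1 φ → ∀ r ≥ 0, (∀ x, r < ‖x‖ → φ x = 0) →
      ∀ᵐ t ∂μ, ∫ x, φ x ∂(A t) = ∫ x, φ x ∂(B t))
    {O : Set E} (hO : IsOpen O) {r : ℝ} (hr : 0 ≤ r) (hOr : O ⊆ closedBall 0 r) :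
    ∀ᵐ t ∂μ, A t O = B t O := by
  obtain ⟨f, hfO, hf, hfr⟩ := hO.exists_contDiff_support_eq (n := 1)
  have hf0 : ∀ x, 0 ≤ f x := fun x => (hfr (mem_range_self x)).1
  let ψ : ℕ → E → ℝ := fun n x => Real.smoothTransition (n * f x)
  have hψ : ∀ n, ContDiff ℝ 1 (ψ n) := fun n =>
    (Real.smoothTransition.contDiff (n := 1)).comp (contDiff_const.mul hf)
  have hψ0 : ∀ n, ∀ x ∉ O, ψ n x = 0 := by
    intro n x hx
    have : f x = 0 := by
      rw [← hfO] at hx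
      exact Function.notMem_support.1 hx
    simp [ψ, this, Real.smoothTransition.zero]
  have hlim : ∀ x, Tendsto (fun n => ψ n x) atTop (𝓝 (O.indicator (fun _ => (1 : ℝ)) x)) := by
    intro x
    by_cases hx : x ∈ O
    · rw [indicator_of_mem hx]
      have hpos : 0 < f x := by
        rw [← hfO] at hx
        exact lt_of_le_of_ne (hf0 x) (Ne.symm hx)
      refine tendsto_const_nhds.congr' ?_
      have ht : Tendsto (fun n : ℕ => (n : ℝ) * f x) atTop atTop :=
        tendsto_natCast_atTop_atTop.atTop_mul_const hpos
      filter_upwards [ht.eventually_ge_atTop 1] with n hn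
      exact (Real.smoothTransition.one_of_one_le hn).symm
    · rw [indicator_of_notMem hx]
      exact tendsto_const_nhds.congr fun n => (hψ0 n x hx).symm
  have hmeas : ∀ m : Measure E, m (closedBall 0 r) < ⊤ →
      Tendsto (fun n => ∫ x, ψ n x ∂m) atTop (𝓝 (m O).toReal) := by
    intro m hm
    have := tendsto_integral_of_dominated_convergence (μ := m)
      (F := ψ) (f := O.indicator fun _ => (1 : ℝ))
      ((closedBall (0 : E) r).indicator fun _ => (1 : ℝ))
      (fun n => (hψ n).continuous.aestronglyMeasurable)
      ((integrable_indicator_iff measurableSet_closedBall).2 (integrableOn_const hm.ne))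
      (fun n => Eventually.of_forall fun x => ?_) (Eventually.of_forall hlim)
    · rwa [integral_indicator hO.measurableSet, setIntegral_const, smul_eq_mul, mul_one] at this
    · by_cases hx : x ∈ O
      · rw [indicator_of_mem (hOr hx), Real.norm_of_nonneg (Real.smoothTransition.nonneg _)]
        exact Real.smoothTransition.le_one _
      · rw [hψ0 n x hx, norm_zero]
        exact indicator_nonneg (fun _ _ => zero_le_one) x
  have hall : ∀ᵐ t ∂μ, ∀ n, ∫ x, ψ n x ∂(A t) = ∫ x, ψ n x ∂(B t) :=
    ae_all_iff.2 fun n => h (ψ n) (hψ n) r hr fun x hx =>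
      hψ0 n x fun hxO => absurd (mem_closedBall_zero_iff.1 (hOr hxO)) (not_le.2 hx)
  filter_upwards [hfin, hall] with t hfin ht
  obtain ⟨hA, hB⟩ := hfin _ (isCompact_closedBall (0 : E) r)
  have h1 := hmeas (A t) hA
  simp only [ht] at h1
  have h2 := tendsto_nhds_unique h1 (hmeas (B t) hB)
  exact (ENNReal.toReal_eq_toReal_iff' ((measure_mono hOr).trans_lt hA).ne
    ((measure_mono hOr).trans_lt hB).ne).1 h2

lemma ae_eq_of_forall_integral_eq
    (hfin : ∀ᵐ t ∂μ, ∀ K : Set E, IsCompact K → A t K < ⊤ ∧ B t K < ⊤)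
    (h : ∀ φ : E → ℝ, ContDiff ℝ 1 φ → ∀ r ≥ 0, (∀ x, r < ‖x‖ → φ x = 0) →
      ∀ᵐ t ∂μ, ∫ x, φ x ∂(A t) = ∫ x, φ x ∂(B t)) :
    ∀ᵐ t ∂μ, A t = B t := by
  obtain ⟨D, hDc, hDpi, hDo, hDu, hDg⟩ := exists_countable_isPiSystem_isOpen E
  have hall : ∀ᵐ t ∂μ, ∀ m : ℕ, ∀ O ∈ D, A t (O ∩ ball 0 m) = B t (O ∩ ball 0 m) :=
    ae_all_iff.2 fun m => (ae_ball_iff hDc).2 fun O hO =>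
      ae_measure_eq_of_isOpen hfin h ((hDo O hO).inter isOpen_ball) m.cast_nonneg
        (inter_subset_right.trans ball_subset_closedBall)
  filter_upwards [hall, hfin] with t ht hfin
  have hr : ∀ m : ℕ, (A t).restrict (ball 0 m) = (B t).restrict (ball 0 m) := by
    intro m
    have : IsFiniteMeasure ((A t).restrict (ball 0 m)) := by
      rw [isFiniteMeasure_restrict]
      exact ((measure_mono ball_subset_closedBall).trans_lt
        (hfin _ (isCompact_closedBall (0 : E) m)).1).ne
    refine ext_of_generate_finite D hDg hDpi (fun O hO => ?_) ?_
    · rw [Measure.restrict_apply (hDo O hO).measurableSet,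
        Measure.restrict_apply (hDo O hO).measurableSet]
      exact ht m O hO
    · rw [Measure.restrict_apply MeasurableSet.univ, Measure.restrict_apply MeasurableSet.univ]
      exact ht m univ hDu
  exact (Measure.ext_iff_of_iUnion_eq_univ (iUnion_ball_nat (0 : E))).2 hr

end Determining

end Preparations

/-- **Theorem 1.** Let `μ¹, μ²` be two solutions of the Cauchy problem
`∂_t μ + div(b μ) = 0`, `μ|_{t=0} = ν` and let `μ_t = μ¹_t - μ²_t`.  If for some
`C₁ ≥ 0` and every ball `U` there are `C₂ ≥ 0`, smooth vector fields `b_k` and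
positive `C¹` functions `V_k` with
(i) `|b_k(x,t)| ≤ C₁ + C₁|x|`,
(ii) `inf_k inf_U V_k > 0` and
`⟨b_k, ∇V_k⟩ ≤ (C₂ - 2 max_{|ξ|=1} ⟨𝓑_k ξ, ξ⟩) V_k` on `U × [0,T]`,
(iii) `∫₀ᵀ ∫_U |b_k - b| √V_k d|μ_t| dt → 0`,
then `μ¹_t = μ²_t` for a.e. `t ∈ [0,T]`. -/
theorem uniqueness_for_continuity_equation
    {d : ℕ} (T : ℝ) (hT : 0 < T)
    (b : EuclideanSpace ℝ (Fin d) → ℝ → EuclideanSpace ℝ (Fin d))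
    (hb : Measurable (fun q : EuclideanSpace ℝ (Fin d) × ℝ => b q.1 q.2))
    (νp νn : Measure (EuclideanSpace ℝ (Fin d)))
    (hν : ∀ K : Set (EuclideanSpace ℝ (Fin d)), IsCompact K → νp K < ⊤ ∧ νn K < ⊤)
    (p₁ n₁ p₂ n₂ : ℝ → Measure (EuclideanSpace ℝ (Fin d)))
    (hfam₁ : IsLocFamily T p₁ n₁) (hfam₂ : IsLocFamily T p₂ n₂)
    (hsol₁ : IsSolution T b νp νn p₁ n₁) (hsol₂ : IsSolution T b νp νn p₂ n₂)
    (C₁ : ℝ) (hC₁ : 0 ≤ C₁)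
    (happrox : ∀ (x₀ : EuclideanSpace ℝ (Fin d)) (R : ℝ), 0 < R →
      ∃ (C₂ : ℝ), 0 ≤ C₂ ∧
      ∃ (bk : ℕ → EuclideanSpace ℝ (Fin d) → ℝ → EuclideanSpace ℝ (Fin d))
        (Vk : ℕ → EuclideanSpace ℝ (Fin d) → ℝ),
        (∀ k, ContDiff ℝ (⊤ : ℕ∞)
          (fun q : EuclideanSpace ℝ (Fin d) × ℝ => bk k q.1 q.2)) ∧
        (∀ k, ContDiff ℝ 1 (Vk k)) ∧
        (∀ k x, 0 < Vk k x) ∧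
        -- (i)
        (∀ k x t, ‖bk k x t‖ ≤ C₁ + C₁ * ‖x‖) ∧
        -- (ii)
        (∃ c > 0, ∀ k, ∀ x ∈ ball x₀ R, c ≤ Vk k x) ∧
        (∀ k, ∀ x ∈ ball x₀ R, ∀ t ∈ Icc (0:ℝ) T,
          ∀ ξ : EuclideanSpace ℝ (Fin d), ‖ξ‖ = 1 →
            ⟪bk k x t, gradient (Vk k) x⟫
              ≤ (C₂ - 2 * ⟪(fderiv ℝ (fun y => bk k y t) x) ξ, ξ⟫) * Vk k x) ∧
        -- (iii)
        Tendsto (fun k => ∫ t in Icc (0:ℝ) T, ∫ x in ball x₀ R,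
            ‖bk k x t - b x t‖ * Real.sqrt (Vk k x)
            ∂(tvDiff (p₁ t + n₂ t) (p₂ t + n₁ t))) atTop (𝓝 0)) :
    ∀ᵐ t ∂(volume.restrict (Icc (0:ℝ) T)),
      p₁ t + n₂ t = p₂ t + n₁ t := by
  refine ae_eq_of_forall_integral_eq ?_ fun φ hφ r hr0 hr => ?_
  · filter_upwards [ae_restrict_mem measurableSet_Icc] with t ht K hK
    have h1 := hfam₁.1 t ht K hK
    have h2 := hfam₂.1 t ht K hK
    exact ⟨ENNReal.add_lt_top.2 ⟨h1.1, h2.2⟩, ENNReal.add_lt_top.2 ⟨h2.1, h1.2⟩⟩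
  set P := (1 + r) * Real.exp (2 * C₁ * T) with hP_def
  have hexp : 1 ≤ Real.exp (2 * C₁ * T) := Real.one_le_exp (by positivity)
  have hrP : 1 + r ≤ P := le_mul_of_one_le_right (by positivity) hexp
  have hP : 0 < P := by positivity
  obtain ⟨C₂, hC₂, g, V, hg, hV, hVpos, hgrow, ⟨v, hv, hVv⟩, hcond, hlim⟩ :=
    happrox 0 (2 * P) (by positivity)
  have hball : closedBall (0 : EuclideanSpace ℝ (Fin d)) P ⊆ ball 0 (2 * P) :=
    closedBall_subset_ball (by linarith)
  have heuler := fun k => exists_isEulerField ((hg k).of_le (by exact_mod_cast le_top)) (hV k)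
    (hVpos k) hC₁ hC₂ (hgrow k) (fun x hx t ht => hcond k x (hball hx) t ht)
  choose δ hδ K hK hE using heuler
  have H := IsSolution.isTransportPair hfam₁ hfam₂ hsol₁ hsol₂ hb (R := 2 * P) (by positivity)
  set a := familyKernel T (2 * P) p₁ hfam₁.measurable_left +
    familyKernel T (2 * P) n₂ hfam₂.measurable_right with ha_def
  set c := familyKernel T (2 * P) p₂ hfam₂.measurable_left +
    familyKernel T (2 * P) n₁ hfam₁.measurable_right with hc_def
  have ha : ∀ s ∈ Icc 0 T, a s = (p₁ s + n₂ s).restrict (ball 0 (2 * P)) := fun s hs => by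
    rw [ha_def, _root_.add_apply, familyKernel_apply _ hs, familyKernel_apply _ hs,
      Measure.restrict_add]
  have hc : ∀ s ∈ Icc 0 T, c s = (p₂ s + n₁ s).restrict (ball 0 (2 * P)) := fun s hs => by
    rw [hc_def, _root_.add_apply, familyKernel_apply _ hs, familyKernel_apply _ hs,
      Measure.restrict_add]
  have hlim' : Tendsto (fun k => ∫ s in Icc 0 T, ∫ x, ‖g k x s - b x s‖ * √(V k x)
      ∂(tvDiff (a s) (c s))) atTop (𝓝 0) := by
    refine hlim.congr fun k => setIntegral_congr_fun measurableSet_Icc fun s hs => ?_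
    simp only [ha s hs, hc s hs, restrict_tvDiff measurableSet_ball]
  have hsupp : ∀ x, r < ‖x‖ → fderiv ℝ φ x = 0 := fun x hx => by
    have ho : IsOpen {y : EuclideanSpace ℝ (Fin d) | r < ‖y‖} :=
      isOpen_lt (by fun_prop) (by fun_prop)
    have : φ =ᶠ[𝓝 x] fun _ => 0 := by
      filter_upwards [ho.mem_nhds hx] with y hy using hr y hy
    rw [this.fderiv_eq, fderiv_const_apply]
  obtain ⟨B, hB⟩ := (isCompact_closedBall (0 : EuclideanSpace ℝ (Fin d))
    r).exists_bound_of_continuousOn (hφ.continuous_fderiv (by norm_num)).continuousOn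
  have hB' : ∀ x, ‖fderiv ℝ φ x‖ ≤ max B 0 := fun x => by
    by_cases hx : ‖x‖ ≤ r
    · exact (hB x (by simpa using hx)).trans (le_max_left _ _)
    · rw [hsupp x (not_le.1 hx), norm_zero]
      exact le_max_right _ _
  have hflux : ∀ s ∈ Icc 0 T, transportFlux a c (fun q => b q.1 q.2) φ s = 0 := fun s hs =>
    H.transportFlux_eq_zero hP
      (fun s => by rw [ha_def, _root_.add_apply, Measure.add_apply, familyKernel_apply_compl,
        familyKernel_apply_compl, add_zero])
      (fun s => by rw [hc_def, _root_.add_apply, Measure.add_apply, familyKernel_apply_compl,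
        familyKernel_apply_compl, add_zero])
      hδ hK hE (fun k => (hV k).continuous) hlim' hφ hr0 hr hB' hv
      (fun k x hx => hVv k x (hball (by rw [mem_closedBall_zero_iff]; linarith))) le_rfl hs
  filter_upwards [H.weak (fun q => φ q.1) (hφ.comp contDiff_fst) r (by linarith)
    (fun x _ hx => hr x hx), ae_restrict_mem measurableSet_Icc] with t ht htT
  have h0 : signedIntegral a c (fun q => φ q.1) t = 0 := ht.trans (hflux t htT)
  have hz : ∀ x ∉ ball (0 : EuclideanSpace ℝ (Fin d)) (2 * P), φ x = 0 := fun x hx =>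
    hr x (by
      rw [mem_ball_zero_iff, not_lt] at hx
      linarith)
  rw [signedIntegral, ha t htT, hc t htT, setIntegral_eq_integral_of_forall_compl_eq_zero hz,
    setIntegral_eq_integral_of_forall_compl_eq_zero hz] at h0
  exact sub_eq_zero.1 h0
end
end

section
/- Let d = 1, let b ∈ C(ℝ) satisfy 0 ≤ b(x) ≤ C + C|x| for every x ∈ ℝ and some number C > 0, and let ν be a locally bounded Borel measure on ℝ. Then the Cauchy problem ∂_t μ + ∂_x(b μ) = 0, μ|_{t=0} = ν has at most one solution in the class of all locally bounded (possibly signed) measures μ on ℝ × [0,T] given by families of locally bounded measures (μ_t)_{t∈[0,T]} such that |μ_t|(∂Z) = 0 for almost all t ∈ [0,T], where ∂Z is the topological boundary of the set Z = {x : b(x) = 0}. -/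
open MeasureTheory Metric Set Filter
open scoped Topology ENNReal

noncomputable section

/-- A family `(μ_t)_{t∈[0,T]}` of locally bounded signed Borel measures on `ℝ`,
represented by its Jordan decomposition `μ_t = p t - n t`:  each `p t`, `n t` is
finite on compact sets and they are mutually singular, `t ↦ μ_t(B)` is measurable
for bounded Borel `B`, and `t ↦ |μ_t|(K)` is in `L¹[0,T]` for every compact `K`. -/
def IsLocFamily1 (T : ℝ) (p n : ℝ → Measure ℝ) : Prop :=
  (∀ t ∈ Icc (0:ℝ) T, ∀ K : Set ℝ, IsCompact K → p t K < ⊤ ∧ n t K < ⊤) ∧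
  (∀ t ∈ Icc (0:ℝ) T, p t ⟂ₘ n t) ∧
  (∀ B : Set ℝ, MeasurableSet B → Bornology.IsBounded B →
      Measurable (fun t => p t B) ∧ Measurable (fun t => n t B)) ∧
  (∀ K : Set ℝ, IsCompact K →
      IntegrableOn (fun t => (p t K).toReal + (n t K).toReal) (Icc (0:ℝ) T))

/-- Integral of `f` against the signed measure `μ_t = p t - n t`. -/
def sint1 (p n : ℝ → Measure ℝ) (t : ℝ) (f : ℝ → ℝ) : ℝ :=
  (∫ x, f x ∂(p t)) - ∫ x, f x ∂(n t)

/-- The family `μ_t = p t - n t` of signed measures on `ℝ` is a solution of the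
Cauchy problem `∂_t μ + ∂_x (b μ) = 0`, `μ|_{t=0} = ν` (`ν = νp - νn`) on `[0,T]`:
`b` is `|μ|`-integrable on `U × [0,T]` for every bounded interval `U` and the
weak identity `∫ u(x,t) μ_t(dx) = ∫ u(x,0) ν(dx) + ∫₀ᵗ ∫ [∂_t u + b ∂_x u] μ_s(dx) ds`
holds for a.e. `t ∈ [0,T]`, for every `C¹` test function `u` vanishing for
`|x| > R` for some `R`. -/
def IsSolution1 (T : ℝ) (b : ℝ → ℝ) (νp νn : Measure ℝ) (p n : ℝ → Measure ℝ) : Prop :=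
  (∀ R : ℝ, 0 < R →
      (∫⁻ t in Icc (0:ℝ) T, ∫⁻ x in ball (0:ℝ) R, ENNReal.ofReal |b x| ∂(p t + n t)) < ⊤) ∧
  ∀ u : ℝ → ℝ → ℝ,
    ContDiff ℝ 1 (fun q : ℝ × ℝ => u q.1 q.2) →
    (∃ R > 0, ∀ x t, R < |x| → u x t = 0) →
    ∀ᵐ t ∂(volume.restrict (Icc (0:ℝ) T)),
      sint1 p n t (fun x => u x t)
        = ((∫ x, u x 0 ∂νp) - ∫ x, u x 0 ∂νn)
          + ∫ s in Icc (0:ℝ) t,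
              sint1 p n s (fun x => deriv (u x) s + b x * deriv (fun y => u y s) x)

/-- A measurable family of locally finite measures whose masses on compact sets are integrable
on `[0,T]`. -/
structure IsLocFiniteFamily (T : ℝ) (q : ℝ → Measure ℝ) : Prop where
  finite : ∀ t ∈ Icc (0:ℝ) T, IsFiniteMeasureOnCompacts (q t)
  measurable : ∀ B : Set ℝ, MeasurableSet B → Bornology.IsBounded B → Measurable fun t => q t B
  integrable : ∀ K : Set ℝ, IsCompact K → IntegrableOn (fun t => (q t K).toReal) (Icc (0:ℝ) T)

lemma IsLocFiniteFamily.add {T : ℝ} {p q : ℝ → Measure ℝ} (hp : IsLocFiniteFamily T p)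
    (hq : IsLocFiniteFamily T q) : IsLocFiniteFamily T (fun t => p t + q t) := by
  have hfin : ∀ t ∈ Icc (0:ℝ) T, IsFiniteMeasureOnCompacts (p t + q t) := fun t ht =>
    ⟨fun K hK => by
      have h1 := (hp.finite t ht).lt_top_of_isCompact hK
      have h2 := (hq.finite t ht).lt_top_of_isCompact hK
      simpa using ⟨h1, h2⟩⟩
  refine ⟨hfin, fun B hB hB' => (hp.measurable B hB hB').add (hq.measurable B hB hB'),
    fun K hK => ?_⟩
  refine ((hp.integrable K hK).add (hq.integrable K hK)).congr_fun (fun t ht => ?_)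
    measurableSet_Icc
  have h1 := (hp.finite t ht).lt_top_of_isCompact hK
  have h2 := (hq.finite t ht).lt_top_of_isCompact hK
  simp [ENNReal.toReal_add h1.ne h2.ne]

lemma IsLocFamily1.isLocFiniteFamily {T : ℝ} {p n : ℝ → Measure ℝ} (h : IsLocFamily1 T p n) :
    IsLocFiniteFamily T p ∧ IsLocFiniteFamily T n := by
  obtain ⟨h1, -, h3, h4⟩ := h
  refine ⟨⟨fun t ht => ⟨fun K hK => (h1 t ht K hK).1⟩, fun B hB hB' => (h3 B hB hB').1,
    fun K hK => ?_⟩, ⟨fun t ht => ⟨fun K hK => (h1 t ht K hK).2⟩,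
    fun B hB hB' => (h3 B hB hB').2, fun K hK => ?_⟩⟩
  · refine (h4 K hK).mono' (h3 K hK.measurableSet hK.isBounded).1.ennreal_toReal.aestronglyMeasurable
      (Eventually.of_forall fun t => ?_)
    rw [Real.norm_of_nonneg ENNReal.toReal_nonneg]
    linarith [ENNReal.toReal_nonneg (a := n t K)]
  · refine (h4 K hK).mono' (h3 K hK.measurableSet hK.isBounded).2.ennreal_toReal.aestronglyMeasurable
      (Eventually.of_forall fun t => ?_)
    rw [Real.norm_of_nonneg ENNReal.toReal_nonneg]
    linarith [ENNReal.toReal_nonneg (a := p t K)]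

lemma integrable_of_bounded_of_eq_zero {μ : Measure ℝ} [IsFiniteMeasureOnCompacts μ] {g : ℝ → ℝ}
    (hg : Measurable g) {M R : ℝ} (hM : ∀ x, |g x| ≤ M) (hR : ∀ x, R < |x| → g x = 0) :
    Integrable g μ := by
  rw [← integrableOn_iff_integrable_of_support_subset (s := closedBall 0 R)]
  · exact Measure.integrableOn_of_bounded (isCompact_closedBall _ _).measure_lt_top.ne
      hg.aestronglyMeasurable (Eventually.of_forall hM)
  · intro x hx
    by_contra h
    exact hx (hR x (by simpa using h))

lemma abs_integral_le_of_bounded_of_eq_zero {μ : Measure ℝ} [IsFiniteMeasureOnCompacts μ]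
    {g : ℝ → ℝ} {M R : ℝ} (hM : ∀ x, |g x| ≤ M) (hR : ∀ x, R < |x| → g x = 0) :
    |∫ x, g x ∂μ| ≤ M * (μ (closedBall 0 R)).toReal := by
  rw [← setIntegral_eq_integral_of_forall_compl_eq_zero (s := closedBall 0 R)
    (fun x hx => hR x (by simpa using hx))]
  exact norm_setIntegral_le_of_norm_le_const (f := g) (isCompact_closedBall _ _).measure_lt_top
    (fun x _ => hM x)

lemma IsLocFiniteFamily.integrableOn_integral {T : ℝ} {q : ℝ → Measure ℝ}
    (hq : IsLocFiniteFamily T q) {g : ℝ → ℝ → ℝ} (hg : Measurable fun z : ℝ × ℝ => g z.1 z.2)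
    {M R : ℝ} (hM : ∀ s ∈ Icc (0:ℝ) T, ∀ x, |g x s| ≤ M) (hR : ∀ x s, R < |x| → g x s = 0) :
    IntegrableOn (fun s => ∫ x, g x s ∂(q s)) (Icc (0:ℝ) T) := by
  set K : Set ℝ := closedBall 0 R with hK
  have hKc : IsCompact K := isCompact_closedBall _ _
  have hm : Measurable fun s => q s K := hq.measurable K hKc.measurableSet hKc.isBounded
  have hκ : Measurable fun s => (1 + q s K)⁻¹ • (q s).restrict K := by
    refine Measure.measurable_of_measurable_coe _ fun B hB => ?_
    simp only [Measure.smul_apply, Measure.restrict_apply hB, smul_eq_mul]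
    exact (measurable_const.add hm).inv.mul
      (hq.measurable _ (hB.inter hKc.measurableSet) (hKc.isBounded.subset inter_subset_right))
  let κ : ProbabilityTheory.Kernel ℝ ℝ := ⟨_, hκ⟩
  have : ProbabilityTheory.IsFiniteKernel κ := ⟨1, by simp, fun s => by
    change ((1 + q s K)⁻¹ • (q s).restrict K) univ ≤ 1
    simp only [Measure.smul_apply, Measure.restrict_apply_univ, smul_eq_mul]
    rw [mul_comm, ← div_eq_mul_inv]
    exact ENNReal.div_le_of_le_mul (by simp)⟩
  have hsm : StronglyMeasurable fun s => ∫ x, g x s ∂(κ s) := by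
    refine StronglyMeasurable.integral_kernel_prod_right (f := fun s x => g x s) ?_
    exact (hg.comp measurable_swap).stronglyMeasurable
  have hprod : StronglyMeasurable fun s => (1 + q s K).toReal * ∫ x, g x s ∂(κ s) :=
    ((measurable_const.add hm).ennreal_toReal.stronglyMeasurable).mul hsm
  have heq : ∀ s ∈ Icc (0:ℝ) T, (1 + q s K).toReal * ∫ x, g x s ∂(κ s) = ∫ x, g x s ∂(q s) := by
    intro s hs
    have hf := ((hq.finite s hs).lt_top_of_isCompact hKc).ne
    change (1 + q s K).toReal * ∫ x, g x s ∂((1 + q s K)⁻¹ • (q s).restrict K) = _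
    rw [integral_smul_measure, setIntegral_eq_integral_of_forall_compl_eq_zero
      (fun x hx => hR x s (by simpa [hK] using hx)), smul_eq_mul, ← mul_assoc, ENNReal.toReal_inv,
      mul_inv_cancel₀, one_mul]
    rw [ENNReal.toReal_add (by simp) hf]
    have := ENNReal.toReal_nonneg (a := q s K)
    simp only [ENNReal.toReal_one]
    positivity
  have haesm : AEStronglyMeasurable (fun s => ∫ x, g x s ∂(q s))
      (volume.restrict (Icc (0:ℝ) T)) :=
    hprod.aestronglyMeasurable.congr
      ((ae_restrict_iff' measurableSet_Icc).2 (Eventually.of_forall heq))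
  refine ((hq.integrable K hKc).const_mul M).mono' haesm
    ((ae_restrict_iff' measurableSet_Icc).2 (Eventually.of_forall fun s hs => ?_))
  have := hq.finite s hs
  exact abs_integral_le_of_bounded_of_eq_zero (hM s hs) (hR · s)

lemma exists_contDiff_tendsto_indicator {V : Set ℝ} (hV : IsOpen V) :
    ∃ ψ : ℕ → ℝ → ℝ, (∀ k, ContDiff ℝ 1 (ψ k)) ∧ (∀ k x, |ψ k x| ≤ 1) ∧
      (∀ k, ∀ x ∉ V, ψ k x = 0) ∧ ∀ x, Tendsto (fun k => ψ k x) atTop (𝓝 (V.indicator 1 x)) := by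
  obtain ⟨f, hsupp, hf, hrange⟩ := hV.exists_contDiff_support_eq (n := 1)
  have hf0 : ∀ x ∉ V, f x = 0 := fun x hx => by
    rw [← hsupp] at hx
    simpa using hx
  refine ⟨fun k x => Real.smoothTransition (k * f x), fun k => ?_, fun k x => ?_, fun k x hx => ?_,
    fun x => ?_⟩
  · exact (Real.smoothTransition.contDiff (n := 1)).comp (contDiff_const.mul hf)
  · rw [abs_of_nonneg (Real.smoothTransition.nonneg _)]
    exact Real.smoothTransition.le_one _
  · simp [hf0 x hx]
  · by_cases hx : x ∈ V
    · have hpos : 0 < f x := lt_of_le_of_ne (hrange ⟨x, rfl⟩).1 (by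
        rw [← hsupp] at hx
        exact Ne.symm hx)
      have hlim : Tendsto (fun k : ℕ => (k:ℝ) * f x) atTop atTop :=
        tendsto_natCast_atTop_atTop.atTop_mul_const hpos
      refine tendsto_const_nhds.congr' ?_
      filter_upwards [hlim.eventually_ge_atTop 1] with k hk
      simp [hx, Real.smoothTransition.one_of_one_le hk]
    · simp [hx, hf0 x hx]

/-- Two families of locally finite measures which integrate alike, for almost every time, each test
function supported in the open set `U`, agree on `U` for almost every time. -/
lemma IsLocFiniteFamily.ae_restrict_eq {T : ℝ} {P N : ℝ → Measure ℝ} (hP : IsLocFiniteFamily T P)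
    (hN : IsLocFiniteFamily T N) {U : Set ℝ} (hU : IsOpen U)
    (h : ∀ ψ : ℝ → ℝ, ContDiff ℝ 1 ψ → (∀ x ∉ U, ψ x = 0) → (∃ R > 0, ∀ x, R < |x| → ψ x = 0) →
      ∀ᵐ t ∂(volume.restrict (Icc (0:ℝ) T)), ∫ x, ψ x ∂(P t) = ∫ x, ψ x ∂(N t)) :
    ∀ᵐ t ∂(volume.restrict (Icc (0:ℝ) T)), (P t).restrict U = (N t).restrict U := by
  have key : ∀ a b : ℚ, ∀ᵐ t ∂(volume.restrict (Icc (0:ℝ) T)),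
      (P t) (Ioo (a:ℝ) b ∩ U) = (N t) (Ioo (a:ℝ) b ∩ U) := by
    intro a b
    set V : Set ℝ := Ioo (a:ℝ) b ∩ U
    have hV : IsOpen V := isOpen_Ioo.inter hU
    obtain ⟨ψ, hψ, hψ1, hψ0, hψlim⟩ := exists_contDiff_tendsto_indicator hV
    have hfar : ∀ k x, |(a:ℝ)| + |(b:ℝ)| + 1 < |x| → ψ k x = 0 := by
      intro k x hx
      refine hψ0 k x fun hxV => ?_
      have h1 := hxV.1.1
      have h2 := hxV.1.2
      have := abs_le_max_abs_abs h1.le h2.le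
      rcases le_max_iff.1 this with h | h <;>
        linarith [abs_nonneg (a:ℝ), abs_nonneg (b:ℝ)]
    have hall := ae_all_iff.2 fun k => h (ψ k) (hψ k) (fun x hx => hψ0 k x fun hxV => hx hxV.2)
      ⟨|(a:ℝ)| + |(b:ℝ)| + 1, by positivity, hfar k⟩
    have hmass : ∀ μ : Measure ℝ, IsFiniteMeasureOnCompacts μ → μ V ≠ ⊤ ∧
        Tendsto (fun k => ∫ x, ψ k x ∂μ) atTop (𝓝 (μ V).toReal) := by
      intro μ hμ
      have hlim := tendsto_integral_of_dominated_convergence (μ := μ)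
        ((closedBall (0:ℝ) (|(a:ℝ)| + |(b:ℝ)| + 1)).indicator 1)
        (fun k => (hψ k).continuous.aestronglyMeasurable)
        ((integrable_indicator_iff measurableSet_closedBall).2
          (integrableOn_const (isCompact_closedBall _ _).measure_lt_top.ne))
        (fun k => Eventually.of_forall fun x => ?_) (Eventually.of_forall hψlim)
      · refine ⟨?_, ?_⟩
        · exact ((measure_mono (inter_subset_left.trans Ioo_subset_Icc_self)).trans_lt
            isCompact_Icc.measure_lt_top).ne
        · rwa [integral_indicator_one hV.measurableSet] at hlim
      · by_cases hx : x ∈ closedBall (0:ℝ) (|(a:ℝ)| + |(b:ℝ)| + 1)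
        · simpa [indicator_of_mem hx] using hψ1 k x
        · simp [indicator_of_notMem hx, hfar k x (by simpa using hx)]
    filter_upwards [hall, ae_restrict_mem measurableSet_Icc] with t ht htI
    obtain ⟨hPf, hPl⟩ := hmass _ (hP.finite t htI)
    obtain ⟨hNf, hNl⟩ := hmass _ (hN.finite t htI)
    exact (ENNReal.toReal_eq_toReal_iff' hPf hNf).1
      (tendsto_nhds_unique (hPl.congr ht) hNl)
  filter_upwards [ae_all_iff.2 fun a => ae_all_iff.2 (key a), ae_restrict_mem measurableSet_Icc]
    with t ht htI
  have := hP.finite t htI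
  refine Real.measure_ext_Ioo_rat fun a b => ?_
  rw [Measure.restrict_apply measurableSet_Ioo, Measure.restrict_apply measurableSet_Ioo]
  exact ht a b

/-- Travel time and flow of the scalar equation `x' = b x + ε`: the function `F` straightens the
drift, `G` is its inverse, and the growth of `b` bounds the distance covered in a given time
uniformly in `ε`. -/
lemma exists_travel_time {b : ℝ → ℝ} (hb : Continuous b) {C : ℝ} (hC : 0 < C)
    (hb0 : ∀ x, 0 ≤ b x) (hgrowth : ∀ x, b x ≤ C + C * |x|) {ε : ℝ} (hε : 0 < ε) (hε1 : ε ≤ 1) :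
    ∃ F G : ℝ → ℝ, (∀ x, HasDerivAt F (b x + ε)⁻¹ x) ∧ (∀ z, HasDerivAt G (b (G z) + ε) z) ∧
      (∀ x, G (F x) = x) ∧ (∀ z, F (G z) = z) ∧
      ∀ x y, |Real.arsinh x - Real.arsinh y| ≤ 2 * (C + 1) * |F x - F y| := by
  have hpos : ∀ x, 0 < b x + ε := fun x => by linarith [hb0 x]
  have hcont : Continuous fun x => (b x + ε)⁻¹ :=
    (hb.add continuous_const).inv₀ fun x => (hpos x).ne'
  set F : ℝ → ℝ := fun x => ∫ y in (0:ℝ)..x, (b y + ε)⁻¹ with hF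
  have hFd : ∀ x, HasDerivAt F (b x + ε)⁻¹ x := fun x =>
    intervalIntegral.integral_hasDerivAt_right (hcont.intervalIntegrable _ _)
      (hcont.stronglyMeasurableAtFilter _ _) hcont.continuousAt
  have hFmono : StrictMono F := strictMono_of_hasDerivAt_pos hFd fun x => inv_pos.2 (hpos x)
  have hmono : Monotone fun x => 2 * (C + 1) * F x - Real.arsinh x := by
    have hd : ∀ x, HasDerivAt (fun x => 2 * (C + 1) * F x - Real.arsinh x)
        (2 * (C + 1) * (b x + ε)⁻¹ - (√(1 + x ^ 2))⁻¹) x := fun x =>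
      ((hFd x).const_mul _).sub (Real.hasDerivAt_arsinh x)
    refine monotone_of_deriv_nonneg (fun x => (hd x).differentiableAt) fun x => ?_
    rw [(hd x).deriv, sub_nonneg, ← div_eq_mul_inv, inv_eq_one_div,
      div_le_div_iff₀ (by positivity) (hpos x), one_mul]
    have h1 : 1 ≤ √(1 + x ^ 2) := Real.one_le_sqrt.2 (by nlinarith)
    have h2 : |x| ≤ √(1 + x ^ 2) := Real.abs_le_sqrt (by linarith)
    nlinarith [hgrowth x, mul_le_mul_of_nonneg_left h2 hC.le, mul_le_mul_of_nonneg_left h1 hC.le]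
  have hle : ∀ x y, y ≤ x → Real.arsinh x - Real.arsinh y ≤ 2 * (C + 1) * (F x - F y) := by
    intro x y hxy
    have := hmono hxy
    simp only at this
    linarith
  have habs : ∀ x y, |Real.arsinh x - Real.arsinh y| ≤ 2 * (C + 1) * |F x - F y| := by
    intro x y
    rcases le_total y x with hxy | hxy
    · rw [abs_of_nonneg (sub_nonneg.2 (Real.arsinh_le_arsinh.2 hxy)),
        abs_of_nonneg (sub_nonneg.2 (hFmono.monotone hxy))]
      exact hle x y hxy
    · rw [abs_sub_comm, abs_sub_comm (F x),
        abs_of_nonneg (sub_nonneg.2 (Real.arsinh_le_arsinh.2 hxy)),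
        abs_of_nonneg (sub_nonneg.2 (hFmono.monotone hxy))]
      exact hle y x hxy
  have hFcont : Continuous F := continuous_iff_continuousAt.2 fun x => (hFd x).continuousAt
  have hF0 : F 0 = 0 := by simp [hF]
  have hC2 : 0 < 2 * (C + 1) := by linarith
  have htop : Tendsto F atTop atTop := by
    have h1 : Tendsto (fun x => Real.arsinh x / (2 * (C + 1))) atTop atTop :=
      (Real.sinhOrderIso.symm.tendsto_atTop).atTop_div_const hC2
    refine tendsto_atTop_mono' _ ?_ h1
    filter_upwards [eventually_ge_atTop 0] with x hx
    have := hle x 0 hx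
    rw [div_le_iff₀ hC2]
    simp only [Real.arsinh_zero, hF0] at this
    linarith
  have hbot : Tendsto F atBot atBot := by
    have h1 : Tendsto (fun x => Real.arsinh x / (2 * (C + 1))) atBot atBot :=
      (Real.sinhOrderIso.symm.tendsto_atBot).atBot_div_const hC2
    refine tendsto_atBot_mono' _ ?_ h1
    filter_upwards [eventually_le_atBot 0] with x hx
    have := hle 0 x hx
    rw [le_div_iff₀ hC2]
    simp only [Real.arsinh_zero, hF0] at this
    linarith
  let e := hFmono.orderIsoOfSurjective F (hFcont.surjective htop hbot)
  have hFe : ∀ z, F (e.symm z) = z := fun z => e.apply_symm_apply z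
  refine ⟨F, e.symm, hFd, fun z => ?_, fun x => e.symm_apply_apply x, hFe, habs⟩
  have := HasDerivAt.of_local_left_inverse e.symm.continuous.continuousAt (hFd (e.symm z))
    (inv_pos.2 (hpos _)).ne' (Eventually.of_forall hFe)
  simpa using this

lemma continuous_transport_derivative {b : ℝ → ℝ} (hb : Continuous b) {u : ℝ → ℝ → ℝ}
    (hu : ContDiff ℝ 1 fun q : ℝ × ℝ => u q.1 q.2) :
    Continuous fun q : ℝ × ℝ => deriv (u q.1) q.2 + b q.1 * deriv (fun y => u y q.2) q.1 := by
  have hc : Continuous (fderiv ℝ fun q : ℝ × ℝ => u q.1 q.2) := hu.continuous_fderiv one_ne_zero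
  have hd : ∀ q : ℝ × ℝ, HasFDerivAt (fun q : ℝ × ℝ => u q.1 q.2)
      (fderiv ℝ (fun q : ℝ × ℝ => u q.1 q.2) q) q := fun q =>
    (hu.differentiable one_ne_zero q).hasFDerivAt
  have h1 : ∀ q : ℝ × ℝ, deriv (u q.1) q.2
      = fderiv ℝ (fun q : ℝ × ℝ => u q.1 q.2) q (0, 1) := fun q =>
    ((hd q).comp_hasDerivAt (f := fun t => (q.1, t)) q.2 ((hasDerivAt_const q.2 q.1).prodMk (hasDerivAt_id q.2))).deriv
  have h2 : ∀ q : ℝ × ℝ, deriv (fun y => u y q.2) q.1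
      = fderiv ℝ (fun q : ℝ × ℝ => u q.1 q.2) q (1, 0) := fun q =>
    ((hd q).comp_hasDerivAt (f := fun y => (y, q.2)) q.1 ((hasDerivAt_id q.1).prodMk (hasDerivAt_const q.1 q.2))).deriv
  simp only [h1, h2]
  exact (hc.clm_apply continuous_const).add
    ((hb.comp continuous_fst).mul (hc.clm_apply continuous_const))

lemma transport_derivative_eq_zero {b : ℝ → ℝ} {u : ℝ → ℝ → ℝ} {R : ℝ}
    (hR : ∀ x t, R < |x| → u x t = 0) {x : ℝ} (s : ℝ) (hx : R < |x|) :
    deriv (u x) s + b x * deriv (fun y => u y s) x = 0 := by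
  have h1 : u x = fun _ => 0 := funext fun t => hR x t hx
  have h2 : (fun y => u y s) =ᶠ[𝓝 x] fun _ => 0 := by
    filter_upwards [continuous_abs.continuousAt.eventually (lt_mem_nhds hx)] with y hy
    exact hR y s hy
  rw [h2.deriv_eq, h1]
  simp

lemma exists_bound_transport_derivative {b : ℝ → ℝ} (hb : Continuous b) {u : ℝ → ℝ → ℝ}
    (hu : ContDiff ℝ 1 fun q : ℝ × ℝ => u q.1 q.2) {R : ℝ}
    (hR : ∀ x t, R < |x| → u x t = 0) (T : ℝ) :
    ∃ M, ∀ s ∈ Icc (0:ℝ) T, ∀ x, |deriv (u x) s + b x * deriv (fun y => u y s) x| ≤ M := by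
  obtain ⟨M, hM⟩ := ((isCompact_closedBall (0:ℝ) R).prod
    (isCompact_Icc (a := (0:ℝ)) (b := T))).exists_bound_of_continuousOn
    (continuous_transport_derivative hb hu).continuousOn
  refine ⟨max M 0, fun s hs x => ?_⟩
  by_cases hx : R < |x|
  · simp [transport_derivative_eq_zero (b := b) hR s hx]
  · exact (hM (x, s) ⟨by simpa using hx, hs⟩).trans (le_max_left _ _)

/-- Approximate solutions of the backward dual problem with terminal value `ψ`: transporting `ψ`
along the regularized drift `b + ε` leaves a residue controlled by `ε / (b + ε)`. -/
lemma exists_approximate_dual_solution {b : ℝ → ℝ} (hb : Continuous b) {C : ℝ} (hC : 0 < C)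
    (hb0 : ∀ x, 0 ≤ b x) (hgrowth : ∀ x, b x ≤ C + C * |x|) {T : ℝ} (hT : 0 < T) {ψ : ℝ → ℝ}
    (hψ : ContDiff ℝ 1 ψ) {R : ℝ} (hψR : ∀ x, R < |x| → ψ x = 0) :
    ∃ M R' : ℝ, 0 ≤ M ∧ 0 < R' ∧ ∀ ε, 0 < ε → ε ≤ 1 → ∃ w : ℝ → ℝ → ℝ,
      (∀ x, Continuous (w x)) ∧ (∀ r, Continuous fun x => w x r) ∧ (∀ x, w x 0 = ψ x) ∧
      ∀ τ, |τ| ≤ T + 1 → ∃ u : ℝ → ℝ → ℝ, ContDiff ℝ 1 (fun q : ℝ × ℝ => u q.1 q.2) ∧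
        (∀ x t, R' < |x| → u x t = 0) ∧ (∀ x t, |u x t| ≤ M) ∧
        ∀ s ∈ Icc (0:ℝ) T, ∀ x, u x s = w x (τ - s) ∧
          |deriv (u x) s + b x * deriv (fun y => u y s) x| ≤ M * (ε / (b x + ε)) := by
  have hψ' : Continuous (deriv ψ) := hψ.continuous_deriv le_rfl
  have hsupp : HasCompactSupport ψ := HasCompactSupport.intro (isCompact_closedBall (0:ℝ) R)
    fun x hx => hψR x (by simpa using hx)
  obtain ⟨M₁, hM₁⟩ := hsupp.exists_bound_of_continuous hψ.continuous
  obtain ⟨M₂, hM₂⟩ := (hsupp.deriv.mul_right (f' := fun x => b x + 1)).exists_bound_of_continuous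
    (hψ'.mul (hb.add continuous_const))
  set S : ℝ := 2 * T + 3
  set L : ℝ := Real.arsinh R + 2 * (C + 1) * S with hL
  have hM₁0 : 0 ≤ M₁ := (norm_nonneg _).trans (hM₁ 0)
  refine ⟨max M₁ M₂, |Real.sinh L| + 1, hM₁0.trans (le_max_left _ _), by positivity,
    fun ε hε hε1 => ?_⟩
  obtain ⟨F, G, hF, hG, hGF, hFG, hdist⟩ := exists_travel_time hb hC hb0 hgrowth hε hε1
  have hpos : ∀ x, 0 < b x + ε := fun x => by linarith [hb0 x]
  have hFdiff : ContDiff ℝ 1 F := contDiff_one_iff_deriv.2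
    ⟨fun x => (hF x).differentiableAt, by
      rw [show deriv F = fun x => (b x + ε)⁻¹ from funext fun x => (hF x).deriv]
      exact (hb.add continuous_const).inv₀ fun x => (hpos x).ne'⟩
  have hGcont : Continuous G := continuous_iff_continuousAt.2 fun z => (hG z).continuousAt
  have hGdiff : ContDiff ℝ 1 G := contDiff_one_iff_deriv.2
    ⟨fun z => (hG z).differentiableAt, by
      rw [show deriv G = fun z => b (G z) + ε from funext fun z => (hG z).deriv]
      exact (hb.comp hGcont).add continuous_const⟩
  refine ⟨fun x r => ψ (G (F x + r)), fun x => ?_, fun r => ?_, fun x => by simp [hGF],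
    fun τ hτ => ?_⟩
  · exact hψ.continuous.comp (hGcont.comp (continuous_const.add continuous_id))
  · exact hψ.continuous.comp (hGcont.comp (hFdiff.continuous.add continuous_const))
  let θ : ContDiffBump (0:ℝ) := ⟨T + 1, T + 2, by linarith, by linarith⟩
  have hθ1 : ∀ s ∈ Icc (0:ℝ) T, θ =ᶠ[𝓝 s] 1 := fun s hs => θ.eventuallyEq_one_of_mem_ball (by
    change s ∈ ball (0:ℝ) (T + 1)
    rw [mem_ball_zero_iff, Real.norm_eq_abs, abs_lt]
    constructor <;> linarith [hs.1, hs.2])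
  refine ⟨fun x t => θ t * ψ (G (F x + (τ - t))), ?_, fun x t hx => ?_, fun x t => ?_,
    fun s hs x => ⟨?_, ?_⟩⟩
  · exact (θ.contDiff.comp contDiff_snd).mul (hψ.comp (hGdiff.comp
      ((hFdiff.comp contDiff_fst).add (contDiff_const.sub contDiff_snd))))
  · by_contra hne
    obtain ⟨hθt, hψt⟩ := mul_ne_zero_iff.1 hne
    have ht : |t| < T + 2 := by
      by_contra hcon
      exact hθt (θ.zero_of_le_dist (by simpa [θ] using hcon))
    set Y := G (F x + (τ - t)) with hY
    have hYR : |Y| ≤ R := by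
      by_contra hcon
      exact hψt (hψR _ (not_le.1 hcon))
    have hYs : |Real.arsinh Y| ≤ Real.arsinh R := by
      rw [abs_le] at hYR ⊢
      rw [← Real.arsinh_neg]
      exact ⟨Real.arsinh_le_arsinh.2 hYR.1, Real.arsinh_le_arsinh.2 hYR.2⟩
    have hd := hdist x Y
    have hS : |F x - F Y| ≤ S := by
      rw [hY, hFG]
      rw [abs_le] at hτ ⊢
      rw [abs_lt] at ht
      constructor <;> simp only [S] <;> linarith [hτ.1, hτ.2, ht.1, ht.2]
    have hx' : |Real.arsinh x| ≤ L := by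
      have h1 : |Real.arsinh x| ≤ |Real.arsinh x - Real.arsinh Y| + |Real.arsinh Y| := by
        simpa using abs_add_le (Real.arsinh x - Real.arsinh Y) (Real.arsinh Y)
      have h2 := mul_le_mul_of_nonneg_left hS (by linarith : 0 ≤ 2 * (C + 1))
      linarith
    have hxL : |x| ≤ Real.sinh L := by
      rw [abs_le] at hx' ⊢
      rw [← Real.sinh_neg]
      constructor
      · simpa using Real.sinh_le_sinh.2 hx'.1
      · simpa using Real.sinh_le_sinh.2 hx'.2
    linarith [le_abs_self (Real.sinh L)]
  · rw [abs_mul, abs_of_nonneg θ.nonneg]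
    calc θ t * |ψ (G (F x + (τ - t)))| ≤ 1 * M₁ :=
          mul_le_mul θ.le_one (hM₁ _) (abs_nonneg _) zero_le_one
      _ ≤ _ := by rw [one_mul]; exact le_max_left _ _
  · simp [(hθ1 s hs).eq_of_nhds]
  · set Y := G (F x + (τ - s)) with hY
    have hψd : HasDerivAt ψ (deriv ψ Y) Y := (hψ.differentiable one_ne_zero Y).hasDerivAt
    have ht : HasDerivAt (fun t => ψ (G (F x + (τ - t)))) (deriv ψ Y * ((b Y + ε) * (-1))) s :=
      hψd.comp s ((hG _).comp s (((hasDerivAt_id s).const_sub τ).const_add (F x)))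
    have hxd : HasDerivAt (fun y => ψ (G (F y + (τ - s))))
        (deriv ψ Y * ((b Y + ε) * (b x + ε)⁻¹)) x :=
      hψd.comp x ((hG _).comp x ((hF x).add_const (τ - s)))
    have h1 : deriv (fun t => θ t * ψ (G (F x + (τ - t)))) s = deriv ψ Y * ((b Y + ε) * (-1)) := by
      rw [← ht.deriv]
      refine Filter.EventuallyEq.deriv_eq ?_
      filter_upwards [hθ1 s hs] with t ht
      simp [ht]
    have h2 : deriv (fun y => θ s * ψ (G (F y + (τ - s)))) x
        = deriv ψ Y * ((b Y + ε) * (b x + ε)⁻¹) := by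
      rw [(hxd.const_mul (θ s)).deriv, (hθ1 s hs).eq_of_nhds]
      simp
    rw [h1, h2]
    have hx0 := (hpos x).ne'
    have h3 : deriv ψ Y * ((b Y + ε) * (-1)) + b x * (deriv ψ Y * ((b Y + ε) * (b x + ε)⁻¹))
        = -(deriv ψ Y * (b Y + ε)) * (ε / (b x + ε)) := by
      field_simp
      ring
    rw [h3, abs_mul, abs_neg, abs_of_pos (div_pos hε (hpos x))]
    refine mul_le_mul_of_nonneg_right ?_ (div_pos hε (hpos x)).le
    refine le_trans ?_ ((hM₂ Y).trans (le_max_right _ _))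
    rw [Pi.mul_apply, norm_mul, abs_mul, Real.norm_eq_abs, Real.norm_eq_abs]
    refine mul_le_mul_of_nonneg_left ?_ (abs_nonneg _)
    rw [abs_of_pos (hpos Y), abs_of_nonneg (by linarith [hb0 Y])]
    linarith

lemma abs_integral_sub_le_of_restrict_eq {P N : Measure ℝ} {Z : Set ℝ} (hZ : MeasurableSet Z)
    (h : P.restrict Z = N.restrict Z) {g φ : ℝ → ℝ} (hgP : Integrable g P) (hgN : Integrable g N)
    (hφP : Integrable φ P) (hφN : Integrable φ N) (hφ0 : ∀ x, 0 ≤ φ x)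
    (hgφ : ∀ x ∉ Z, |g x| ≤ φ x) :
    |∫ x, g x ∂P - ∫ x, g x ∂N| ≤ ∫ x, φ x ∂P + ∫ x, φ x ∂N := by
  have hle : ∀ μ : Measure ℝ, Integrable φ μ → |∫ x in Zᶜ, g x ∂μ| ≤ ∫ x, φ x ∂μ := by
    intro μ hφ
    rw [← integral_indicator hZ.compl]
    refine norm_integral_le_of_norm_le (f := Zᶜ.indicator g) hφ (Eventually.of_forall fun x => ?_)
    by_cases hx : x ∈ Z
    · simpa [hx] using hφ0 x
    · simpa [hx] using hgφ x hx
  rw [← integral_add_compl hZ hgP, ← integral_add_compl hZ hgN, h, add_sub_add_left_eq_sub]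
  exact (abs_sub _ _).trans (add_le_add (hle P hφP) (hle N hφN))

/-- Two families of locally finite measures whose difference solves the continuity equation with
zero initial datum coincide, provided neither charges the boundary of the zero set of `b`. -/
lemma ae_eq_of_continuity_equation {T : ℝ} (hT : 0 < T) {b : ℝ → ℝ} (hb : Continuous b) {C : ℝ}
    (hC : 0 < C) (hb0 : ∀ x, 0 ≤ b x) (hgrowth : ∀ x, b x ≤ C + C * |x|)
    {P N : ℝ → Measure ℝ} (hP : IsLocFiniteFamily T P) (hN : IsLocFiniteFamily T N)
    (hsol : ∀ u : ℝ → ℝ → ℝ, ContDiff ℝ 1 (fun q : ℝ × ℝ => u q.1 q.2) →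
      (∃ R > 0, ∀ x t, R < |x| → u x t = 0) →
      ∀ᵐ t ∂(volume.restrict (Icc (0:ℝ) T)), ∫ x, u x t ∂(P t) - ∫ x, u x t ∂(N t)
        = ∫ s in Icc (0:ℝ) t,
            (∫ x, (deriv (u x) s + b x * deriv (fun y => u y s) x) ∂(P s)
              - ∫ x, (deriv (u x) s + b x * deriv (fun y => u y s) x) ∂(N s)))
    (hPZ : ∀ᵐ t ∂(volume.restrict (Icc (0:ℝ) T)), P t (frontier {x : ℝ | b x = 0}) = 0)
    (hNZ : ∀ᵐ t ∂(volume.restrict (Icc (0:ℝ) T)), N t (frontier {x : ℝ | b x = 0}) = 0) :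
    ∀ᵐ t ∂(volume.restrict (Icc (0:ℝ) T)), P t = N t := by
  set Z : Set ℝ := {x : ℝ | b x = 0}
  have hZc : IsClosed Z := isClosed_eq hb continuous_const
  have hint : ∀ᵐ t ∂(volume.restrict (Icc (0:ℝ) T)),
      (P t).restrict (interior Z) = (N t).restrict (interior Z) := by
    refine hP.ae_restrict_eq hN isOpen_interior fun ψ hψ hψZ ⟨R, hR, hψR⟩ => ?_
    filter_upwards [hsol (fun x _ => ψ x) (hψ.comp contDiff_fst) ⟨R, hR, fun x _ => hψR x⟩]
      with t ht
    have hz : ∀ x, b x * deriv ψ x = 0 := by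
      intro x
      by_cases hx : x ∈ Z
      · rw [show b x = 0 from hx, zero_mul]
      · have : ψ =ᶠ[𝓝 x] fun _ => 0 := by
          filter_upwards [hZc.isOpen_compl.mem_nhds hx] with y hy
          exact hψZ y fun h => hy (interior_subset h)
        rw [this.deriv_eq, deriv_const, mul_zero]
    simp only [deriv_const, zero_add, hz, integral_zero, sub_self] at ht
    exact sub_eq_zero.1 ht
  have hZeq : ∀ᵐ t ∂(volume.restrict (Icc (0:ℝ) T)), (P t).restrict Z = (N t).restrict Z := by
    have haux : ∀ μ : Measure ℝ, μ (frontier Z) = 0 → μ.restrict Z = μ.restrict (interior Z) := by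
      intro μ hμ
      refine Measure.restrict_congr_set ?_
      refine (ae_le_set.2 ?_).antisymm (Eventually.of_forall interior_subset)
      rwa [← hZc.frontier_eq]
    filter_upwards [hint, hPZ, hNZ] with t h1 h2 h3
    rw [haux _ h2, haux _ h3, h1]
  have huniv : ∀ᵐ t ∂(volume.restrict (Icc (0:ℝ) T)),
      (P t).restrict univ = (N t).restrict univ := by
    refine hP.ae_restrict_eq hN isOpen_univ fun ψ hψ _ ⟨R, hR, hψR⟩ => ?_
    obtain ⟨M, R', hM0, hR', hdual⟩ :=
      exists_approximate_dual_solution hb hC hb0 hgrowth hT hψ hψR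
    set ε : ℕ → ℝ := fun k => 1 / ((k:ℝ) + 1)
    have hε : ∀ k, 0 < ε k := fun k => by positivity
    have hε1 : ∀ k, ε k ≤ 1 := fun k => by
      simp only [ε]
      rw [div_le_one (by positivity)]
      linarith [(Nat.cast_nonneg k : (0:ℝ) ≤ k)]
    choose w hw1 hw2 hw0 hw using fun k => hdual (ε k) (hε k) (hε1 k)
    set φ : ℕ → ℝ → ℝ := fun k =>
      (closedBall (0:ℝ) R' \ Z).indicator fun x => ε k / (b x + ε k) with hφ
    have hpos : ∀ k x, 0 < b x + ε k := fun k x => by linarith [hb0 x, hε k]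
    have hφ0 : ∀ k x, 0 ≤ φ k x := fun k x =>
      indicator_nonneg (fun y _ => (div_pos (hε k) (hpos k y)).le) x
    have hφ1 : ∀ k x, |φ k x| ≤ 1 := by
      intro k x
      rw [abs_of_nonneg (hφ0 k x)]
      refine indicator_apply_le' (fun _ => ?_) fun _ => zero_le_one
      rw [div_le_one (hpos k x)]
      linarith [hb0 x]
    have hφR : ∀ k x, R' < |x| → φ k x = 0 := fun k x hx =>
      indicator_of_notMem (fun h => absurd h.1 (by simpa using hx)) _
    have hφm : ∀ k, Measurable (φ k) := fun k =>
      (measurable_const.div (hb.measurable.add measurable_const)).indicator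
        (measurableSet_closedBall.diff hZc.measurableSet)
    have hφlim : ∀ x, Tendsto (fun k => φ k x) atTop (𝓝 0) := by
      intro x
      by_cases hx : x ∈ closedBall (0:ℝ) R' \ Z
      · have hε0 : Tendsto ε atTop (𝓝 0) := tendsto_one_div_add_atTop_nhds_zero_nat
        have hbx : b x + 0 ≠ 0 := by
          rw [add_zero]
          exact hx.2
        have hdiv := hε0.div (hε0.const_add (b x)) hbx
        rw [zero_div] at hdiv
        exact hdiv.congr fun k => (indicator_of_mem hx _).symm
      · simp only [hφ, indicator_of_notMem hx, tendsto_const_nhds]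
    have hlim : ∀ {q : ℝ → Measure ℝ}, IsLocFiniteFamily T q →
        (∀ k, IntegrableOn (fun s => ∫ x, φ k x ∂(q s)) (Icc (0:ℝ) T)) ∧
        Tendsto (fun k => ∫ s in Icc (0:ℝ) T, ∫ x, φ k x ∂(q s)) atTop (𝓝 0) := by
      intro q hq
      have hi : ∀ k, IntegrableOn (fun s => ∫ x, φ k x ∂(q s)) (Icc (0:ℝ) T) := fun k =>
        hq.integrableOn_integral (g := fun x _ => φ k x) ((hφm k).comp measurable_fst)
          (fun s _ => hφ1 k) (fun x _ => hφR k x)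
      refine ⟨hi, ?_⟩
      suffices h : Tendsto (fun k => ∫ s in Icc (0:ℝ) T, ∫ x, φ k x ∂(q s)) atTop
          (𝓝 (∫ _ in Icc (0:ℝ) T, (0:ℝ))) by
        rwa [integral_zero] at h
      refine tendsto_integral_of_dominated_convergence
        (fun s => (q s (closedBall (0:ℝ) R')).toReal) (fun k => (hi k).aestronglyMeasurable)
        (hq.integrable _ (isCompact_closedBall _ _)) (fun k => ?_) ?_
      · filter_upwards [ae_restrict_mem measurableSet_Icc] with s hs
        have := hq.finite s hs
        simpa using abs_integral_le_of_bounded_of_eq_zero (μ := q s) (hφ1 k) (hφR k)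
      · filter_upwards [ae_restrict_mem measurableSet_Icc] with s hs
        have := hq.finite s hs
        rw [← integral_zero ℝ ℝ (μ := q s)]
        refine tendsto_integral_of_dominated_convergence ((closedBall (0:ℝ) R').indicator 1)
          (fun k => (hφm k).aestronglyMeasurable)
          ((integrable_indicator_iff measurableSet_closedBall).2
            (integrableOn_const (isCompact_closedBall _ _).measure_lt_top.ne))
          (fun k => Eventually.of_forall fun x => ?_) (Eventually.of_forall hφlim)
        by_cases hx : x ∈ closedBall (0:ℝ) R'
        · simpa [indicator_of_mem hx] using hφ1 k x
        · simp [indicator_of_notMem hx, hφR k x (by simpa using hx)]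
    obtain ⟨hPi, hPl⟩ := hlim hP
    obtain ⟨hNi, hNl⟩ := hlim hN
    set δ : ℕ → ℝ := fun k => ∫ s in Icc (0:ℝ) T,
      (M * (∫ x, φ k x ∂(P s) + ∫ x, φ k x ∂(N s))) with hδ
    have hδl : Tendsto δ atTop (𝓝 0) := by
      have hδ' : ∀ k, M * ((∫ s in Icc (0:ℝ) T, ∫ x, φ k x ∂(P s))
          + ∫ s in Icc (0:ℝ) T, ∫ x, φ k x ∂(N s)) = δ k := fun k => by
        simp only [hδ]
        rw [integral_const_mul, integral_add (hPi k) (hNi k)]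
      have := ((hPl.add hNl).const_mul M).congr hδ'
      simpa using this
    have hbound : ∀ (k : ℕ) (τ : ℚ), ∀ᵐ t ∂(volume.restrict (Icc (0:ℝ) T)), |(τ:ℝ)| ≤ T + 1 →
        |∫ x, w k x (τ - t) ∂(P t) - ∫ x, w k x (τ - t) ∂(N t)| ≤ δ k := by
      intro k τ
      by_cases hτ : |(τ:ℝ)| ≤ T + 1
      swap
      · exact Eventually.of_forall fun t h => absurd h hτ
      obtain ⟨u, hu, huR, -, huw⟩ := hw k τ hτ
      obtain ⟨M', hM'⟩ := exists_bound_transport_derivative hb hu huR T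
      have hres : ∀ᵐ s ∂(volume.restrict (Icc (0:ℝ) T)),
          ‖∫ x, (deriv (u x) s + b x * deriv (fun y => u y s) x) ∂(P s)
            - ∫ x, (deriv (u x) s + b x * deriv (fun y => u y s) x) ∂(N s)‖
          ≤ M * (∫ x, φ k x ∂(P s) + ∫ x, φ k x ∂(N s)) := by
        filter_upwards [hZeq, ae_restrict_mem measurableSet_Icc] with s hs hsI
        have := hP.finite s hsI
        have := hN.finite s hsI
        have hgm : Measurable fun x => deriv (u x) s + b x * deriv (fun y => u y s) x :=
          ((continuous_transport_derivative hb hu).comp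
            (Continuous.prodMk_left s)).measurable
        have hg0 : ∀ x, R' < |x| → deriv (u x) s + b x * deriv (fun y => u y s) x = 0 :=
          fun x hx => transport_derivative_eq_zero huR s hx
        have hφi : ∀ μ : Measure ℝ, IsFiniteMeasureOnCompacts μ → Integrable (φ k) μ :=
          fun μ _ => integrable_of_bounded_of_eq_zero (hφm k) (hφ1 k) (hφR k)
        refine (abs_integral_sub_le_of_restrict_eq hZc.measurableSet hs
          (integrable_of_bounded_of_eq_zero hgm (hM' s hsI) hg0)
          (integrable_of_bounded_of_eq_zero hgm (hM' s hsI) hg0)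
          ((hφi _ ‹_›).const_mul M) ((hφi _ ‹_›).const_mul M)
          (fun x => mul_nonneg hM0 (hφ0 k x)) fun x hx => ?_).trans_eq ?_
        · by_cases hxR : R' < |x|
          · rw [hg0 x hxR, abs_zero]
            exact mul_nonneg hM0 (hφ0 k x)
          · refine ((huw s hsI x).2).trans_eq ?_
            have hmem : x ∈ closedBall (0:ℝ) R' \ Z := ⟨by simpa using hxR, hx⟩
            simp only [hφ, indicator_of_mem hmem]
        · rw [integral_const_mul, integral_const_mul, mul_add]
      have hmajor : IntegrableOn (fun s => M * (∫ x, φ k x ∂(P s) + ∫ x, φ k x ∂(N s)))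
          (Icc (0:ℝ) T) := ((hPi k).add (hNi k)).const_mul M
      filter_upwards [hsol u hu ⟨R', hR', huR⟩, ae_restrict_mem measurableSet_Icc] with t ht htI _
      have hsub : Icc (0:ℝ) t ⊆ Icc 0 T := Icc_subset_Icc_right htI.2
      simp only [← fun x => (huw t htI x).1]
      rw [ht]
      refine (norm_integral_le_of_norm_le (hmajor.mono_set hsub)
        (ae_restrict_of_ae_restrict_of_subset hsub hres)).trans ?_
      refine setIntegral_mono_set hmajor (Eventually.of_forall fun s => ?_) hsub.eventuallyLE
      exact mul_nonneg hM0 (add_nonneg (integral_nonneg (hφ0 k)) (integral_nonneg (hφ0 k)))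
    filter_upwards [ae_all_iff.2 fun k => ae_all_iff.2 (hbound k), ae_restrict_mem measurableSet_Icc]
      with t ht htI
    have hPt := hP.finite t htI
    have hNt := hN.finite t htI
    have hψδ : ∀ k, |∫ x, ψ x ∂(P t) - ∫ x, ψ x ∂(N t)| ≤ δ k := by
      intro k
      have hne := Rat.isDenseEmbedding_coe_real.toIsDenseInducing.comap_nhds_neBot t
      set l : Filter ℚ := comap ((↑) : ℚ → ℝ) (𝓝 t)
      have hcast : Tendsto ((↑) : ℚ → ℝ) l (𝓝 t) := tendsto_comap
      have hev : ∀ᶠ τ : ℚ in l, |(τ:ℝ)| ≤ T + 1 := by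
        refine hcast.eventually (p := fun y => |y| ≤ T + 1) ?_
        filter_upwards [ball_mem_nhds t one_pos] with y hy
        rw [mem_ball, Real.dist_eq, abs_lt] at hy
        rw [abs_le]
        constructor <;> linarith [htI.1, htI.2, hy.1, hy.2]
      have hconv : ∀ μ : Measure ℝ, IsFiniteMeasureOnCompacts μ →
          Tendsto (fun τ : ℚ => ∫ x, w k x (τ - t) ∂μ) l (𝓝 (∫ x, ψ x ∂μ)) := by
        intro μ _
        refine tendsto_integral_filter_of_dominated_convergence
          ((closedBall (0:ℝ) R').indicator fun _ => M)
          (Eventually.of_forall fun τ => (hw2 k _).aestronglyMeasurable) ?_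
          ((integrable_indicator_iff measurableSet_closedBall).2
            (integrableOn_const (isCompact_closedBall _ _).measure_lt_top.ne))
          (Eventually.of_forall fun x => ?_)
        · filter_upwards [hev] with τ hτ
          obtain ⟨u, -, huR, huM, huw⟩ := hw k τ hτ
          refine Eventually.of_forall fun x => ?_
          rw [← (huw t htI x).1]
          by_cases hx : x ∈ closedBall (0:ℝ) R'
          · simpa [indicator_of_mem hx] using huM x t
          · simp [indicator_of_notMem hx, huR x t (by simpa using hx)]
        · have h1 : Tendsto (fun τ : ℚ => (τ:ℝ) - t) l (𝓝 0) := by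
            simpa using hcast.sub_const t
          rw [← hw0 k x]
          exact (hw1 k x).continuousAt.tendsto.comp h1
      refine le_of_tendsto ((hconv _ hPt).sub (hconv _ hNt)).abs ?_
      filter_upwards [hev] with τ hτ
      exact ht k τ hτ
    have h0 : |∫ x, ψ x ∂(P t) - ∫ x, ψ x ∂(N t)| ≤ 0 :=
      ge_of_tendsto hδl (Eventually.of_forall hψδ)
    exact sub_eq_zero.1 (abs_nonpos_iff.1 h0)
  filter_upwards [huniv] with t ht
  simpa using ht

/-- **Corollary 1.** Let `b ∈ C(ℝ)` with `0 ≤ b(x) ≤ C + C|x|` for some `C > 0`.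
Then the Cauchy problem `∂_t μ + ∂_x (b μ) = 0`, `μ|_{t=0} = ν` has at most one
solution in the class of all locally bounded (possibly signed) measures
`μ = μ_t dt` given by families of locally bounded measures with
`|μ_t|(∂Z) = 0` for a.e. `t ∈ [0,T]`, where `Z = {x : b(x) = 0}`. -/
theorem uniqueness_dim_one_nonneg_drift
    (T : ℝ) (hT : 0 < T)
    (b : ℝ → ℝ) (hb : Continuous b)
    (C : ℝ) (hC : 0 < C)
    (hb0 : ∀ x, 0 ≤ b x) (hgrowth : ∀ x, b x ≤ C + C * |x|)
    (νp νn : Measure ℝ) (hν : ∀ K : Set ℝ, IsCompact K → νp K < ⊤ ∧ νn K < ⊤)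
    (p₁ n₁ p₂ n₂ : ℝ → Measure ℝ)
    (hfam₁ : IsLocFamily1 T p₁ n₁) (hfam₂ : IsLocFamily1 T p₂ n₂)
    (hsol₁ : IsSolution1 T b νp νn p₁ n₁) (hsol₂ : IsSolution1 T b νp νn p₂ n₂)
    (hZ₁ : ∀ᵐ t ∂(volume.restrict (Icc (0:ℝ) T)),
      (p₁ t + n₁ t) (frontier {x : ℝ | b x = 0}) = 0)
    (hZ₂ : ∀ᵐ t ∂(volume.restrict (Icc (0:ℝ) T)),
      (p₂ t + n₂ t) (frontier {x : ℝ | b x = 0}) = 0) :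
    ∀ᵐ t ∂(volume.restrict (Icc (0:ℝ) T)), p₁ t + n₂ t = p₂ t + n₁ t := by
  obtain ⟨hp₁, hn₁⟩ := hfam₁.isLocFiniteFamily
  obtain ⟨hp₂, hn₂⟩ := hfam₂.isLocFiniteFamily
  refine ae_eq_of_continuity_equation hT hb hC hb0 hgrowth (hp₁.add hn₂) (hp₂.add hn₁) ?_ ?_ ?_
  · rintro u hu ⟨R, hR, huR⟩
    set L : ℝ → ℝ → ℝ := fun x s => deriv (u x) s + b x * deriv (fun y => u y s) x
    have hLc := continuous_transport_derivative hb hu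
    obtain ⟨M, hM⟩ := exists_bound_transport_derivative hb hu huR T
    have hL0 : ∀ x s, R < |x| → L x s = 0 := fun x s hx => transport_derivative_eq_zero huR s hx
    have hLi : ∀ s ∈ Icc (0:ℝ) T, ∀ μ : Measure ℝ, IsFiniteMeasureOnCompacts μ →
        Integrable (fun x => L x s) μ := fun s hs μ _ =>
      integrable_of_bounded_of_eq_zero (hLc.comp (Continuous.prodMk_left s)).measurable
        (hM s hs) (hL0 · s)
    have hLint : ∀ {q : ℝ → Measure ℝ}, IsLocFiniteFamily T q →
        IntegrableOn (fun s => ∫ x, L x s ∂(q s)) (Icc (0:ℝ) T) := fun hq =>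
      hq.integrableOn_integral hLc.measurable hM hL0
    have hui : ∀ t, ∀ μ : Measure ℝ, IsFiniteMeasureOnCompacts μ →
        Integrable (fun x => u x t) μ := fun t μ _ => by
      have hc : Continuous fun x => u x t := hu.continuous.comp (Continuous.prodMk_left t)
      exact hc.integrable_of_hasCompactSupport
        (HasCompactSupport.intro (isCompact_closedBall (0:ℝ) R) fun x hx =>
          huR x t (by simpa using hx))
    filter_upwards [hsol₁.2 u hu ⟨R, hR, huR⟩, hsol₂.2 u hu ⟨R, hR, huR⟩,
      ae_restrict_mem measurableSet_Icc] with t h1 h2 htI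
    have hsub : Icc (0:ℝ) t ⊆ Icc 0 T := Icc_subset_Icc_right htI.2
    have hsplit : ∫ s in Icc (0:ℝ) t, (∫ x, L x s ∂(p₁ s + n₂ s) - ∫ x, L x s ∂(p₂ s + n₁ s))
        = (∫ s in Icc (0:ℝ) t, sint1 p₁ n₁ s fun x => L x s)
          - ∫ s in Icc (0:ℝ) t, sint1 p₂ n₂ s fun x => L x s := by
      have hdiff : ∀ {p n : ℝ → Measure ℝ}, IsLocFiniteFamily T p → IsLocFiniteFamily T n →
          IntegrableOn (fun s => sint1 p n s fun x => L x s) (Icc (0:ℝ) t) := fun hp hn =>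
        ((hLint hp).sub (hLint hn)).mono_set hsub
      rw [← integral_sub (hdiff hp₁ hn₁) (hdiff hp₂ hn₂)]
      refine setIntegral_congr_fun measurableSet_Icc fun s hs => ?_
      have hs' := hsub hs
      simp only [sint1]
      rw [integral_add_measure (hLi s hs' _ (hp₁.finite s hs')) (hLi s hs' _ (hn₂.finite s hs')),
        integral_add_measure (hLi s hs' _ (hp₂.finite s hs')) (hLi s hs' _ (hn₁.finite s hs'))]
      ring
    rw [hsplit,
      integral_add_measure (hui t _ (hp₁.finite t htI)) (hui t _ (hn₂.finite t htI)),
      integral_add_measure (hui t _ (hp₂.finite t htI)) (hui t _ (hn₁.finite t htI))]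
    simp only [sint1] at h1 h2 ⊢
    linarith
  · filter_upwards [hZ₁, hZ₂] with t h1 h2
    simp only [Measure.add_apply, add_eq_zero] at h1 h2 ⊢
    exact ⟨h1.1, h2.2⟩
  · filter_upwards [hZ₁, hZ₂] with t h1 h2
    simp only [Measure.add_apply, add_eq_zero] at h1 h2 ⊢
    exact ⟨h2.1, h1.2⟩
end
end
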